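/- Assume the setting of the end-to-end Coarse-ID control theorem, except that each experiment is corrupted both by process noise entering through the control channel and by measurement noise: y_i = Toep(u_i)g_{0:T−1} + Toep(g_{0:T−1})w_i + ξ_i, with w_i i.i.d. N(0, σ_w²I_T) and ξ_i i.i.d. N(0, σ_ξ²I_T), all independent. Then the conclusions of that theorem (stabilization of the true plant by the robust SLS controller, and the stated suboptimality bound, with probability at least 1 − η) hold with σ² replaced by σ_w²‖G‖² + σ_ξ², where ‖G‖ is the H∞ norm of the true plant G. -/

import Mathlib

/- Preliminaries: transfer functions as real rational functions, RH∞, H∞ norms,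
   System-Level Synthesis (SLS) constraints, controllers, closed-loop responses,
   coarse-grained identification, Gaussian vectors. -/

noncomputable section
open scoped Matrix BigOperators ENNReal
open MeasureTheory ProbabilityTheory Polynomial

namespace SLS

/-- Scalar transfer functions: real rational functions in `z`. -/
abbrev TF : Type := RatFunc ℝ

/-- Transfer matrices. -/
abbrev TMat (m n : ℕ) : Type := Matrix (Fin m) (Fin n) TF

/-- Embed a real matrix as a (constant) transfer matrix. -/
def rmap {m n : ℕ} (A : Matrix (Fin m) (Fin n) ℝ) : TMat m n := A.map RatFunc.C

/-- Evaluate a scalar transfer function at a complex point. -/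
def evalTF (f : TF) (z : ℂ) : ℂ :=
  (f.num.map (algebraMap ℝ ℂ)).eval z / (f.denom.map (algebraMap ℝ ℂ)).eval z

/-- Evaluate a transfer matrix at a complex point. -/
def evalMat {m n : ℕ} (F : TMat m n) (z : ℂ) : Matrix (Fin m) (Fin n) ℂ :=
  Matrix.of fun i j => evalTF (F i j) z

/-- Spectral norm (ℓ2 → ℓ2 operator norm) of a matrix over `ℝ` or `ℂ`. -/
def specNorm {𝕜 : Type} [RCLike 𝕜] {m n : ℕ} (M : Matrix (Fin m) (Fin n) 𝕜) : ℝ :=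
  ‖LinearMap.toContinuousLinearMap (Matrix.toEuclideanLin M)‖

/-- H∞ norm of a transfer matrix: sup over the unit circle of the spectral norm. -/
def hinfNorm {m n : ℕ} (F : TMat m n) : ℝ :=
  sSup {x : ℝ | ∃ z : ℂ, ‖z‖ = 1 ∧ x = specNorm (evalMat F z)}

/-- H∞ norm of a scalar transfer function. -/
def hinfNormTF (f : TF) : ℝ :=
  sSup {x : ℝ | ∃ z : ℂ, ‖z‖ = 1 ∧ x = ‖evalTF f z‖}

/-- A scalar transfer function is proper if its numerator degree does not exceed
its denominator degree. -/
def ProperTF (f : TF) : Prop := f.num.degree ≤ f.denom.degree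

/-- Strictly proper: vanishes at `z = ∞`. -/
def StrictlyProperTF (f : TF) : Prop := f.num.degree < f.denom.degree

/-- Stable: all poles lie strictly inside the open unit disk. -/
def StableTF (f : TF) : Prop :=
  ∀ z : ℂ, (f.denom.map (algebraMap ℝ ℂ)).eval z = 0 → ‖z‖ < 1

/-- Membership in RH∞ for scalar transfer functions: proper and stable. -/
def MemRHinfTF (f : TF) : Prop := ProperTF f ∧ StableTF f

/-- Membership in RH∞ for transfer matrices (entrywise). -/
def MemRHinf {m n : ℕ} (F : TMat m n) : Prop := ∀ i j, MemRHinfTF (F i j)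

/-- Strict properness of a transfer matrix (entrywise). -/
def StrictlyProper {m n : ℕ} (F : TMat m n) : Prop := ∀ i j, StrictlyProperTF (F i j)

/-- The transfer matrix `zI - A` for a real matrix `A`. -/
def zIA {n : ℕ} (A : Matrix (Fin n) (Fin n) ℝ) : TMat n n :=
  Matrix.diagonal (fun _ => (RatFunc.X : TF)) - rmap A

/-- A system response `Θ = {R, M, N, L}` for a plant with `n` states, `p` control
inputs and `q` measured outputs. -/
structure Response (n p q : ℕ) where
  R : TMat n n
  M : TMat p n
  N : TMat n q
  L : TMat p q

/-- The stability part of the SLS constraints: `R, M, N` strictly proper in RH∞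
and `L ∈ RH∞`. -/
def SLSStable {n p q : ℕ} (Θ : Response n p q) : Prop :=
  StrictlyProper Θ.R ∧ StrictlyProper Θ.M ∧ StrictlyProper Θ.N ∧
  MemRHinf Θ.R ∧ MemRHinf Θ.M ∧ MemRHinf Θ.N ∧ MemRHinf Θ.L

/-- The SLS constraints for the plant `(A, B₂, C₂)`:
`[zI − A, −B₂]·[[R, N],[M, L]] = [I, 0]`, `[[R, N],[M, L]]·[zI − A; −C₂] = [I; 0]`,
written blockwise, together with the stability conditions. -/
def SLSConstraints {n p q : ℕ} (A : Matrix (Fin n) (Fin n) ℝ)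
    (B₂ : Matrix (Fin n) (Fin p) ℝ) (C₂ : Matrix (Fin q) (Fin n) ℝ)
    (Θ : Response n p q) : Prop :=
  zIA A * Θ.R - rmap B₂ * Θ.M = 1 ∧
  zIA A * Θ.N - rmap B₂ * Θ.L = 0 ∧
  Θ.R * zIA A - Θ.N * rmap C₂ = 1 ∧
  Θ.M * zIA A - Θ.L * rmap C₂ = 0 ∧
  SLSStable Θ

/-- The robust SLS constraints with perturbations `(Δ₁, Δ₂)`: the second block
equation becomes `[[R, N],[M, L]]·[zI − A; −C₂] = [I + Δ₁; Δ₂]`. -/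
def RobustSLSConstraints {n p q : ℕ} (A : Matrix (Fin n) (Fin n) ℝ)
    (B₂ : Matrix (Fin n) (Fin p) ℝ) (C₂ : Matrix (Fin q) (Fin n) ℝ)
    (Δ₁ : TMat n n) (Δ₂ : TMat p n) (Θ : Response n p q) : Prop :=
  zIA A * Θ.R - rmap B₂ * Θ.M = 1 ∧
  zIA A * Θ.N - rmap B₂ * Θ.L = 0 ∧
  Θ.R * zIA A - Θ.N * rmap C₂ = 1 + Δ₁ ∧
  Θ.M * zIA A - Θ.L * rmap C₂ = Δ₂ ∧
  SLSStable Θ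

/-- The controller `K = L − M R⁻¹ N` induced by a system response. -/
def controller {n p q : ℕ} (Θ : Response n p q) : TMat p q :=
  Θ.L - Θ.M * Θ.R⁻¹ * Θ.N

/-- `K` achieves the closed-loop response `Θ'` on the plant `(A, B₂, C₂)`: in the
feedback loop `x = (zI − A)⁻¹(B₂u + δx)`, `y = C₂x + δy`, `u = Ky`, the transfer
matrices from `(δx, δy)` to `(x, u)` equal `[[R', N'],[M', L']]`. -/
def Achieves {n p q : ℕ} (A : Matrix (Fin n) (Fin n) ℝ)
    (B₂ : Matrix (Fin n) (Fin p) ℝ) (C₂ : Matrix (Fin q) (Fin n) ℝ)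
    (K : TMat p q) (Θ' : Response n p q) : Prop :=
  zIA A * Θ'.R = rmap B₂ * Θ'.M + 1 ∧
  zIA A * Θ'.N = rmap B₂ * Θ'.L ∧
  Θ'.M = K * rmap C₂ * Θ'.R ∧
  Θ'.L = K * rmap C₂ * Θ'.N + K

/-- `K` internally stabilizes the plant `(A, B₂, C₂)`: the four closed-loop
transfer matrices exist, `R', M', N'` are strictly proper, and all four lie in RH∞. -/
def InternallyStabilizes {n p q : ℕ} (A : Matrix (Fin n) (Fin n) ℝ)
    (B₂ : Matrix (Fin n) (Fin p) ℝ) (C₂ : Matrix (Fin q) (Fin n) ℝ)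
    (K : TMat p q) : Prop :=
  ∃ Θ' : Response n p q, Achieves A B₂ C₂ K Θ' ∧ SLSStable Θ'

/-! ### FIR SISO plants -/

/-- The down-shift matrix (ones on the subdiagonal). -/
def shiftMat (n : ℕ) : Matrix (Fin n) (Fin n) ℝ :=
  Matrix.of fun i j => if (i : ℕ) = (j : ℕ) + 1 then 1 else 0

/-- The first standard basis vector, as a column matrix. -/
def e1 (n : ℕ) : Matrix (Fin n) (Fin 1) ℝ :=
  Matrix.of fun i _ => if (i : ℕ) = 0 then 1 else 0

/-- A vector as a row matrix (`gᵀ`). -/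
def rowVec {n : ℕ} (g : Fin n → ℝ) : Matrix (Fin 1) (Fin n) ℝ :=
  Matrix.of fun _ j => g j

/-- The matrix `C₁ = [gᵀ; 0]`. -/
def C1mat {n : ℕ} (g : Fin n → ℝ) : Matrix (Fin 2) (Fin n) ℝ :=
  Matrix.of fun i j => if (i : ℕ) = 0 then g j else 0

/-- The matrix `D₁₂ = [0; 1]`. -/
def D12mat : Matrix (Fin 2) (Fin 1) ℝ :=
  Matrix.of fun i _ => if (i : ℕ) = 1 then 1 else 0

/-- Stack two scalar transfer functions into a 2×1 transfer matrix `[a; b]`. -/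
def col2 (a b : TF) : TMat 2 1 :=
  Matrix.of fun i _ => if (i : ℕ) = 0 then a else b

/-- The H∞ cost `J(g, Θ) = ‖[C₁, D₁₂]·[[R, N],[M, L]]·[B₁; D₂₁] + D₁₁‖` of a
system response for the generalized plant built from FIR coefficients `g`. -/
def cost {n nw : ℕ} (g : Fin n → ℝ) (B₁ : Matrix (Fin n) (Fin nw) ℝ)
    (D₂₁ : Matrix (Fin 1) (Fin nw) ℝ) (D₁₁ : Matrix (Fin 2) (Fin nw) ℝ)
    (Θ : Response n 1 1) : ℝ :=
  hinfNorm ((rmap (C1mat g) * Θ.R + rmap D12mat * Θ.M) * rmap B₁ +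
    (rmap (C1mat g) * Θ.N + rmap D12mat * Θ.L) * rmap D₂₁ + rmap D₁₁)

/-- The transfer matrix `[1 + g̃ᵀÑ; L̃]` and its H∞ norm. -/
def perfWeight {n : ℕ} (g : Fin n → ℝ) (Θ : Response n 1 1) : ℝ :=
  hinfNorm (col2 (1 + (rmap (rowVec g) * Θ.N) 0 0) (Θ.L 0 0))

/-- The robust SLS objective `Q(g̃, Θ̃, α) = J(g̃, Θ̃) + εα‖R̃B₁ + ÑD₂₁‖`. -/
def Qval {n nw : ℕ} (g : Fin n → ℝ) (B₁ : Matrix (Fin n) (Fin nw) ℝ)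
    (D₂₁ : Matrix (Fin 1) (Fin nw) ℝ) (D₁₁ : Matrix (Fin 2) (Fin nw) ℝ)
    (ε : ℝ) (Θ : Response n 1 1) (α : ℝ) : ℝ :=
  cost g B₁ D₂₁ D₁₁ Θ + ε * α * hinfNorm (Θ.R * rmap B₁ + Θ.N * rmap D₂₁)

/-- Feasibility for the robust SLS problem for the estimate `g̃` with uncertainty
parameter `ε`: `α > 0`, `Θ̃` satisfies the SLS constraints for `(Z, e₁, g̃ᵀ)`, and
`εα‖Ñ‖ + ‖[1 + g̃ᵀÑ; L̃]‖ ≤ α`. -/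
def RobustFeasible {n : ℕ} (g : Fin n → ℝ) (ε : ℝ) (Θ : Response n 1 1) (α : ℝ) : Prop :=
  0 < α ∧ SLSConstraints (shiftMat n) (e1 n) (rowVec g) Θ ∧
  ε * α * hinfNorm Θ.N + perfWeight g Θ ≤ α

/-- `(Θ̃, α)` is a minimizer of the robust SLS problem for `g̃`. -/
def RobustOptimal {n nw : ℕ} (g : Fin n → ℝ) (B₁ : Matrix (Fin n) (Fin nw) ℝ)
    (D₂₁ : Matrix (Fin 1) (Fin nw) ℝ) (D₁₁ : Matrix (Fin 2) (Fin nw) ℝ)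
    (ε : ℝ) (Θ : Response n 1 1) (α : ℝ) : Prop :=
  RobustFeasible g ε Θ α ∧
  ∀ Θ' α', RobustFeasible g ε Θ' α' → Qval g B₁ D₂₁ D₁₁ ε Θ α ≤ Qval g B₁ D₂₁ D₁₁ ε Θ' α'

/-- `Θ₀` is a minimizer of `J(g, ·)` over responses satisfying the SLS constraints
for the plant `(Z, e₁, gᵀ)`. -/
def OptimalResponse {n nw : ℕ} (g : Fin n → ℝ) (B₁ : Matrix (Fin n) (Fin nw) ℝ)
    (D₂₁ : Matrix (Fin 1) (Fin nw) ℝ) (D₁₁ : Matrix (Fin 2) (Fin nw) ℝ)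
    (Θ : Response n 1 1) : Prop :=
  SLSConstraints (shiftMat n) (e1 n) (rowVec g) Θ ∧
  ∀ Θ', SLSConstraints (shiftMat n) (e1 n) (rowVec g) Θ' →
    cost g B₁ D₂₁ D₁₁ Θ ≤ cost g B₁ D₂₁ D₁₁ Θ'

/-- The FIR transfer function `G(z) = Σ_{t=1}^{r−1} g_t z^{−t}` for
`g = (g₁, …, g_{r−1})`. -/
def firTF {n : ℕ} (g : Fin n → ℝ) : TF :=
  ∑ t : Fin n, RatFunc.C (g t) * (RatFunc.X)⁻¹ ^ ((t : ℕ) + 1)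

/-- The FIR transfer function `G(z) = Σ_{k=0}^{T−1} g_k z^{−k}` for a full
impulse-response vector `g_{0:T−1}`. -/
def firTF0 {T : ℕ} (g : Fin T → ℝ) : TF :=
  ∑ k : Fin T, RatFunc.C (g k) * (RatFunc.X)⁻¹ ^ (k : ℕ)

/-! ### Coarse-grained identification -/

/-- Euclidean (ℓ2) norm of a finite real vector. -/
def euclNorm {r : ℕ} (x : Fin r → ℝ) : ℝ := Real.sqrt (∑ i, x i ^ 2)

/-- ℓp norm of a finite real vector, `p ∈ [1, ∞]`. -/
def lpNorm {T : ℕ} (p : ℝ≥0∞) (x : Fin T → ℝ) : ℝ :=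
  if p = ∞ then ⨆ i, |x i| else (∑ i, |x i| ^ p.toReal) ^ (1 / p.toReal)

/-- `r^{2/max(p,2)}` as a real number. -/
def rExp (p : ℝ≥0∞) (r : ℕ) : ℝ := (r : ℝ) ^ ((2 / max p 2).toReal)

/-- The T×T lower-triangular Toeplitz matrix whose first column is `u`. -/
def toep {T : ℕ} (u : Fin T → ℝ) : Matrix (Fin T) (Fin T) ℝ :=
  Matrix.of fun i j =>
    if (j : ℕ) ≤ (i : ℕ) then u ⟨(i : ℕ) - (j : ℕ), lt_of_le_of_lt (Nat.sub_le _ _) i.isLt⟩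
    else 0

/-- The stacked input matrix `Z_mat = [Toep(u₁); …; Toep(u_m)]`. -/
def Zmat {T mE : ℕ} (u : Fin mE → Fin T → ℝ) : Matrix (Fin mE × Fin T) (Fin T) ℝ :=
  Matrix.of fun pr j => toep (u pr.1) pr.2 j

/-- `Z_matᵀ Z_mat`. -/
def ZtZ {T mE : ℕ} (u : Fin mE → Fin T → ℝ) : Matrix (Fin T) (Fin T) ℝ :=
  (Zmat u)ᵀ * Zmat u

/-- The least-squares estimate `g̃_{0:T−1} = (Z_matᵀZ_mat)⁻¹Z_matᵀ(y₁; …; y_m)`. -/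
def lsEst {T mE : ℕ} (u : Fin mE → Fin T → ℝ) (y : Fin mE → Fin T → ℝ) : Fin T → ℝ :=
  ((ZtZ u)⁻¹ * (Zmat u)ᵀ).mulVec fun pr => y pr.1 pr.2

/-- Pad the FIR coefficients `g = (g₁, …, g_{r−1})` to the impulse response
`g_{0:T−1} = (0, g₁, …, g_{r−1}, 0, …, 0)`. -/
def pad {r T : ℕ} (_ : r ≤ T) (g : Fin (r - 1) → ℝ) : Fin T → ℝ := fun k =>
  if hk : 1 ≤ (k : ℕ) ∧ (k : ℕ) < r then g ⟨(k : ℕ) - 1, by omega⟩ else 0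

/-- The estimated FIR coefficients `g̃ = (g̃₁, …, g̃_{r−1})` from coarse-grained
identification with true coefficients `g` and additive noise on the outputs. -/
def coarseEst {r T mE : ℕ} (hrT : r ≤ T) (u : Fin mE → Fin T → ℝ)
    (g : Fin (r - 1) → ℝ) (noise : Fin mE → Fin T → ℝ) : Fin (r - 1) → ℝ :=
  fun i =>
    lsEst u (fun k => (toep (u k)).mulVec (pad hrT g) + noise k)
      ⟨(i : ℕ) + 1, by have := i.isLt; omega⟩

/-! ### Gaussian random vectors -/

/-- The standard Gaussian measure on `Fin r → ℝ` (i.i.d. `N(0,1)` coordinates). -/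
def stdGaussianPi (r : ℕ) : Measure (Fin r → ℝ) :=
  Measure.pi fun _ => gaussianReal 0 1

/-- `δ` is a centered Gaussian random vector with covariance `Cov`: its law is the
pushforward of the standard Gaussian under some `A` with `AAᵀ = Cov`. -/
def IsCenteredGaussianVec {Ω : Type} [MeasurableSpace Ω] (P : Measure Ω) {r : ℕ}
    (δ : Ω → Fin r → ℝ) (Cov : Matrix (Fin r) (Fin r) ℝ) : Prop :=
  ∃ A : Matrix (Fin r) (Fin r) ℝ, A * Aᵀ = Cov ∧
    Measure.map δ P = Measure.map (fun x => A.mulVec x) (stdGaussianPi r)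

/-- The law of i.i.d. `N(0, σ²)` noise across `mE` experiments of length `T`. -/
def iidGaussianLaw (mE T : ℕ) (σ2 : ℝ) : Measure (Fin mE → Fin T → ℝ) :=
  Measure.pi fun _ => Measure.pi fun _ => gaussianReal 0 σ2.toNNReal


/-- Scalar multiplication of a transfer matrix by a scalar transfer function. -/
def sMulTF {m n : ℕ} (c : TF) (M : TMat m n) : TMat m n := Matrix.of fun i j => c * M i j

/-- The perturbed response `Θ̂` with `R̂ = (I+Δ₁)⁻¹R̃`, `M̂ = M̃ − Δ₂(I+Δ₁)⁻¹R̃`,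
`N̂ = (I+Δ₁)⁻¹Ñ`, `L̂ = L̃ − Δ₂(I+Δ₁)⁻¹Ñ` (with the rational matrix inverse). -/
def deltaPerturb {n p q : ℕ} (Δ₁ : TMat n n) (Δ₂ : TMat p n) (Θ : Response n p q) :
    Response n p q where
  R := (1 + Δ₁)⁻¹ * Θ.R
  M := Θ.M - Δ₂ * ((1 + Δ₁)⁻¹ * Θ.R)
  N := (1 + Δ₁)⁻¹ * Θ.N
  L := Θ.L - Δ₂ * ((1 + Δ₁)⁻¹ * Θ.N)

/-- The Sherman–Morrison form of the perturbed response in the FIR SISO case: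
`[[R̂, N̂],[M̂, L̂]] = [[R̃, Ñ],[M̃, L̃]] + (1 − δᵀÑ)⁻¹·[Ñδᵀ; L̃δᵀ]·[R̃, Ñ]`. -/
def smPerturb {n : ℕ} (δ : Fin n → ℝ) (Θ : Response n 1 1) : Response n 1 1 where
  R := Θ.R + sMulTF (1 - (rmap (rowVec δ) * Θ.N) 0 0)⁻¹ (Θ.N * rmap (rowVec δ) * Θ.R)
  M := Θ.M + sMulTF (1 - (rmap (rowVec δ) * Θ.N) 0 0)⁻¹ (Θ.L * rmap (rowVec δ) * Θ.R)
  N := Θ.N + sMulTF (1 - (rmap (rowVec δ) * Θ.N) 0 0)⁻¹ (Θ.N * rmap (rowVec δ) * Θ.N)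
  L := Θ.L + sMulTF (1 - (rmap (rowVec δ) * Θ.N) 0 0)⁻¹ (Θ.L * rmap (rowVec δ) * Θ.N)

/-- The block-diagonal matrix with `m` copies of `Toep(g)` on the diagonal
(the action of `Toep(g)` on the stacked process noise of `m` experiments). -/
def bigToep {T mE : ℕ} (g : Fin T → ℝ) : Matrix (Fin mE × Fin T) (Fin mE × Fin T) ℝ :=
  Matrix.of fun pr qr => if pr.1 = qr.1 then toep g pr.2 qr.2 else 0

end SLS

open SLS MeasureTheory

namespace SLS

/-- The valuation at infinity. -/
def vInf : Valuation (RatFunc ℝ) (WithZero (Multiplicative ℤ)) :=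
  letI := Classical.decEq (RatFunc ℝ)
  RatFunc.inftyValuation ℝ

lemma vInf_of_ne {f : TF} (hf : f ≠ 0) : vInf f = WithZero.exp f.intDegree := by
  classical
  unfold vInf
  exact RatFunc.inftyValuation_of_nonzero ℝ hf

lemma proper_iff (f : TF) : ProperTF f ↔ vInf f ≤ 1 := by
  unfold ProperTF
  by_cases hf : f = 0
  · subst hf; simp
  · rw [vInf_of_ne hf, ← WithZero.exp_zero, WithZero.exp_le_exp,
      Polynomial.degree_eq_natDegree (RatFunc.num_ne_zero hf),
      Polynomial.degree_eq_natDegree (RatFunc.denom_ne_zero f), RatFunc.intDegree]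
    rw [Nat.cast_le]
    omega

lemma sproper_iff (f : TF) : StrictlyProperTF f ↔ vInf f < 1 := by
  unfold StrictlyProperTF
  by_cases hf : f = 0
  · subst hf; simp
  · rw [vInf_of_ne hf, ← WithZero.exp_zero, WithZero.exp_lt_exp,
      Polynomial.degree_eq_natDegree (RatFunc.num_ne_zero hf),
      Polynomial.degree_eq_natDegree (RatFunc.denom_ne_zero f), RatFunc.intDegree]
    rw [Nat.cast_lt]
    omega

lemma evalTF_eq (f : TF) (z : ℂ) : evalTF f z = RatFunc.eval (algebraMap ℝ ℂ) z f := by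
  simp [evalTF, RatFunc.eval, Polynomial.eval_map]

lemma StableTF.ne {f : TF} (h : StableTF f) {z : ℂ} (hz : 1 ≤ ‖z‖) :
    Polynomial.eval₂ (algebraMap ℝ ℂ) z f.denom ≠ 0 := by
  intro h0
  have := h z (by rw [Polynomial.eval_map]; exact h0)
  linarith

lemma stable_of_dvd {f : TF} {q : ℝ[X]} (h : f.denom ∣ q)
    (hq : ∀ z : ℂ, Polynomial.eval₂ (algebraMap ℝ ℂ) z q = 0 → ‖z‖ < 1) : StableTF f := by
  intro z hz
  rw [Polynomial.eval_map] at hz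
  exact hq z (Polynomial.eval₂_eq_zero_of_dvd_of_eval₂_eq_zero _ _ h hz)

lemma StableTF.add {f g : TF} (hf : StableTF f) (hg : StableTF g) : StableTF (f + g) := by
  refine stable_of_dvd (RatFunc.denom_add_dvd f g) fun z hz => ?_
  rw [Polynomial.eval₂_mul, mul_eq_zero, ← Polynomial.eval_map, ← Polynomial.eval_map] at hz
  exact hz.elim (hf z) (hg z)

lemma StableTF.mul {f g : TF} (hf : StableTF f) (hg : StableTF g) : StableTF (f * g) := by
  refine stable_of_dvd (RatFunc.denom_mul_dvd f g) fun z hz => ?_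
  rw [Polynomial.eval₂_mul, mul_eq_zero, ← Polynomial.eval_map, ← Polynomial.eval_map] at hz
  exact hz.elim (hf z) (hg z)

lemma stable_C (a : ℝ) : StableTF (RatFunc.C a) := by
  intro z hz
  simp at hz

lemma stable_Xinv : StableTF (RatFunc.X)⁻¹ := by
  refine stable_of_dvd (RatFunc.denom_inv_dvd RatFunc.X_ne_zero) fun z hz => ?_
  simp at hz
  simp [hz]

lemma evalTF_add {f g : TF} (hf : StableTF f) (hg : StableTF g) {z : ℂ} (hz : 1 ≤ ‖z‖) :
    evalTF (f + g) z = evalTF f z + evalTF g z := by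
  simp only [evalTF_eq]
  exact RatFunc.eval_add _ _ (hf.ne hz) (hg.ne hz)

lemma evalTF_mul {f g : TF} (hf : StableTF f) (hg : StableTF g) {z : ℂ} (hz : 1 ≤ ‖z‖) :
    evalTF (f * g) z = evalTF f z * evalTF g z := by
  simp only [evalTF_eq]
  exact RatFunc.eval_mul _ _ (hf.ne hz) (hg.ne hz)

@[simp] lemma evalTF_C (a : ℝ) (z : ℂ) : evalTF (RatFunc.C a) z = a := by
  simp [evalTF_eq]

@[simp] lemma evalTF_one (z : ℂ) : evalTF 1 z = 1 := by
  simp [evalTF_eq]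

@[simp] lemma evalTF_zero (z : ℂ) : evalTF 0 z = 0 := by
  simp [evalTF_eq]

lemma rh_C (a : ℝ) : MemRHinfTF (RatFunc.C a) := by
  refine ⟨?_, stable_C a⟩
  rw [proper_iff]
  by_cases h : a = 0
  · subst h; simp
  · rw [vInf_of_ne (by simpa using h)]; simp

lemma rh_one : MemRHinfTF 1 := by simpa using rh_C 1
lemma rh_zero : MemRHinfTF 0 := by simpa using rh_C 0

lemma MemRHinfTF.add {f g : TF} (hf : MemRHinfTF f) (hg : MemRHinfTF g) : MemRHinfTF (f + g) := by
  refine ⟨?_, hf.2.add hg.2⟩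
  have h1 := (proper_iff f).1 hf.1
  have h2 := (proper_iff g).1 hg.1
  exact (proper_iff _).2 (vInf.map_add_le h1 h2)

lemma MemRHinfTF.mul {f g : TF} (hf : MemRHinfTF f) (hg : MemRHinfTF g) : MemRHinfTF (f * g) := by
  refine ⟨?_, hf.2.mul hg.2⟩
  have h1 := (proper_iff f).1 hf.1
  have h2 := (proper_iff g).1 hg.1
  rw [proper_iff, map_mul]
  exact mul_le_one' h1 h2

lemma MemRHinfTF.neg {f : TF} (hf : MemRHinfTF f) : MemRHinfTF (-f) := by
  have : -f = RatFunc.C (-1) * f := by simp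
  rw [this]; exact (rh_C _).mul hf

lemma MemRHinfTF.sub {f g : TF} (hf : MemRHinfTF f) (hg : MemRHinfTF g) : MemRHinfTF (f - g) := by
  rw [sub_eq_add_neg]; exact hf.add hg.neg

lemma rh_sum {ι : Type*} (s : Finset ι) (f : ι → TF) (hf : ∀ i ∈ s, MemRHinfTF (f i)) :
    MemRHinfTF (∑ i ∈ s, f i) := by
  classical
  induction s using Finset.induction_on with
  | empty => simpa using rh_zero
  | insert a s ha ih =>
    rw [Finset.sum_insert ha]
    exact (hf a (by simp)).add (ih fun i hi => hf i (by simp [hi]))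

lemma evalTF_neg {f : TF} (hf : StableTF f) {z : ℂ} (hz : 1 ≤ ‖z‖) :
    evalTF (-f) z = - evalTF f z := by
  have : -f = RatFunc.C (-1) * f := by simp
  rw [this, evalTF_mul (stable_C _) hf hz, evalTF_C]; simp

lemma evalTF_sub {f g : TF} (hf : MemRHinfTF f) (hg : MemRHinfTF g) {z : ℂ} (hz : 1 ≤ ‖z‖) :
    evalTF (f - g) z = evalTF f z - evalTF g z := by
  rw [sub_eq_add_neg, evalTF_add hf.2 hg.neg.2 hz, evalTF_neg hg.2 hz, sub_eq_add_neg]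

lemma evalTF_sum {ι : Type*} (s : Finset ι) (f : ι → TF) (hf : ∀ i ∈ s, MemRHinfTF (f i))
    {z : ℂ} (hz : 1 ≤ ‖z‖) : evalTF (∑ i ∈ s, f i) z = ∑ i ∈ s, evalTF (f i) z := by
  classical
  induction s using Finset.induction_on with
  | empty => simp
  | insert a s ha ih =>
    rw [Finset.sum_insert ha, Finset.sum_insert ha, evalTF_add (hf a (by simp)).2
      (rh_sum s f fun i hi => hf i (by simp [hi])).2 hz, ih fun i hi => hf i (by simp [hi])]

lemma rh_Xinv : MemRHinfTF (RatFunc.X)⁻¹ := by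
  refine ⟨?_, stable_Xinv⟩
  rw [proper_iff, vInf_of_ne (inv_ne_zero RatFunc.X_ne_zero), ← WithZero.exp_zero,
    WithZero.exp_le_exp, RatFunc.intDegree_inv]
  simp

lemma rh_pow {f : TF} (hf : MemRHinfTF f) (k : ℕ) : MemRHinfTF (f ^ k) := by
  induction k with
  | zero => simpa using rh_one
  | succ k ih => rw [pow_succ]; exact ih.mul hf

lemma evalTF_pow {f : TF} (hf : MemRHinfTF f) (k : ℕ) {z : ℂ} (hz : 1 ≤ ‖z‖) :
    evalTF (f ^ k) z = evalTF f z ^ k := by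
  induction k with
  | zero => simp
  | succ k ih => rw [pow_succ, evalTF_mul (rh_pow hf k).2 hf.2 hz, ih, pow_succ]

lemma stable_X : StableTF RatFunc.X := by
  intro z hz; simp at hz

lemma evalTF_Xinv {z : ℂ} (hz : 1 ≤ ‖z‖) : evalTF (RatFunc.X)⁻¹ z = z⁻¹ := by
  have h : evalTF ((RatFunc.X)⁻¹ * RatFunc.X) z = 1 := by
    rw [inv_mul_cancel₀ RatFunc.X_ne_zero]; simp
  rw [evalTF_mul stable_Xinv stable_X hz] at h
  have : evalTF RatFunc.X z = z := by simp [evalTF_eq]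
  rw [this] at h
  exact eq_inv_of_mul_eq_one_left h

lemma rh_fir {n : ℕ} (g : Fin n → ℝ) : MemRHinfTF (firTF g) :=
  rh_sum _ _ fun _ _ => (rh_C _).mul (rh_pow rh_Xinv _)

lemma evalTF_fir {n : ℕ} (g : Fin n → ℝ) {z : ℂ} (hz : 1 ≤ ‖z‖) :
    evalTF (firTF g) z = ∑ t : Fin n, (g t : ℂ) * (z⁻¹) ^ ((t : ℕ) + 1) := by
  unfold firTF
  rw [evalTF_sum _ _ (fun _ _ => (rh_C _).mul (rh_pow rh_Xinv _)) hz]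
  refine Finset.sum_congr rfl fun t _ => ?_
  rw [evalTF_mul (rh_C _).2 (rh_pow rh_Xinv _).2 hz, evalTF_pow rh_Xinv _ hz, evalTF_Xinv hz]
  simp

lemma continuousOn_evalTF {f : TF} (hf : StableTF f) :
    ContinuousOn (evalTF f) {z : ℂ | 1 ≤ ‖z‖} := by
  unfold evalTF
  refine ContinuousOn.div (Polynomial.continuous _).continuousOn
    (Polynomial.continuous _).continuousOn fun z hz => ?_
  rw [Polynomial.eval_map]
  exact hf.ne hz

end SLS

namespace SLS

lemma maxmod {f : TF} (hf : MemRHinfTF f) {c : ℝ}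
    (hc : ∀ z : ℂ, ‖z‖ = 1 → ‖evalTF f z‖ ≤ c) {z : ℂ} (hz : 1 ≤ ‖z‖) : ‖evalTF f z‖ ≤ c := by
  set d := f.denom.natDegree with hd
  have hp : f.num.natDegree ≤ d := Polynomial.natDegree_le_natDegree hf.1
  let h : ℂ → ℂ := fun w => Polynomial.eval₂ (algebraMap ℝ ℂ) w (Polynomial.reflect d f.num) /
    Polynomial.eval₂ (algebraMap ℝ ℂ) w (Polynomial.reflect d f.denom)
  have key : ∀ (p : ℝ[X]), p.natDegree ≤ d → ∀ w : ℂ, w ≠ 0 →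
      Polynomial.eval₂ (algebraMap ℝ ℂ) w (Polynomial.reflect d p) =
        Polynomial.eval₂ (algebraMap ℝ ℂ) w⁻¹ p * w ^ d := by
    intro p hp w hw
    let _ : Invertible w⁻¹ := invertibleOfNonzero (inv_ne_zero hw)
    have := Polynomial.eval₂_reflect_mul_pow (algebraMap ℝ ℂ) w⁻¹ d p hp
    rw [← this]
    simp only [invOf_eq_inv, inv_inv]
    rw [mul_assoc, ← mul_pow, inv_mul_cancel₀ hw, one_pow, mul_one]
  have hh : ∀ w : ℂ, w ≠ 0 → h w = evalTF f w⁻¹ := by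
    intro w hw
    simp only [h]
    rw [key _ hp w hw, key _ le_rfl w hw, evalTF_eq, RatFunc.eval,
      mul_div_mul_right _ _ (pow_ne_zero _ hw)]
  have hden : ∀ w : ℂ, ‖w‖ ≤ 1 →
      Polynomial.eval₂ (algebraMap ℝ ℂ) w (Polynomial.reflect d f.denom) ≠ 0 := by
    intro w hw
    by_cases h0 : w = 0
    · subst h0
      rw [Polynomial.eval₂_at_zero, Polynomial.coeff_reflect, Polynomial.revAt_zero, hd]
      rw [Polynomial.coeff_natDegree, (RatFunc.monic_denom f).leadingCoeff]
      simp
    · rw [key _ le_rfl w h0]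
      refine mul_ne_zero (hf.2.ne ?_) (pow_ne_zero _ h0)
      rw [norm_inv]
      exact (one_le_inv₀ (norm_pos_iff.2 h0)).2 hw
  have hdiff : ∀ w : ℂ, ‖w‖ ≤ 1 → DifferentiableAt ℂ h w := by
    intro w hw
    refine DifferentiableAt.div ?_ ?_ (hden w hw)
    · simp only [← Polynomial.eval_map]; exact Polynomial.differentiableAt _
    · simp only [← Polynomial.eval_map]; exact Polynomial.differentiableAt _
  have hz0 : z ≠ 0 := by rintro rfl; norm_num at hz
  have hw : ‖z⁻¹‖ ≤ 1 := by rw [norm_inv]; exact inv_le_one_of_one_le₀ hz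
  have := Complex.norm_le_of_forall_mem_frontier_norm_le (U := Metric.ball (0:ℂ) 1) (f := h)
    (C := c) (z := z⁻¹) Metric.isBounded_ball
    (by
      refine DifferentiableOn.diffContOnCl ?_
      rw [closure_ball _ one_ne_zero]
      intro w hw
      exact (hdiff w (by simpa using hw)).differentiableWithinAt)
    (by
      rw [frontier_ball _ one_ne_zero]
      intro w hw
      have hw1 : ‖w‖ = 1 := by simpa using hw
      rw [hh w (by rintro rfl; norm_num at hw1)]
      exact hc _ (by rw [norm_inv, hw1, inv_one]))
    (by rw [closure_ball _ one_ne_zero]; simpa using hw)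
  rwa [hh _ (inv_ne_zero hz0), inv_inv] at this

lemma eq_zero_of_circle {f : TF} (hf : MemRHinfTF f)
    (hc : ∀ z : ℂ, ‖z‖ = 1 → evalTF f z = 0) : f = 0 := by
  by_contra hne
  have h1 : ∀ z : ℂ, 1 ≤ ‖z‖ → Polynomial.eval z (f.num.map (algebraMap ℝ ℂ)) = 0 := by
    intro z hz
    have := maxmod hf (c := 0) (fun z hz => by simp [hc z hz]) hz
    have h0 : evalTF f z = 0 := by simpa using this
    rw [evalTF, div_eq_zero_iff] at h0
    refine h0.resolve_right ?_
    rw [Polynomial.eval_map]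
    exact hf.2.ne hz
  have h2 : f.num.map (algebraMap ℝ ℂ) = 0 := by
    refine Polynomial.eq_zero_of_infinite_isRoot _ ?_
    refine Set.infinite_of_injective_forall_mem (f := fun n : ℕ => ((n + 1 : ℕ) : ℂ)) ?_ ?_
    · intro a b hab
      simpa using hab
    · intro n
      refine h1 _ ?_
      rw [Complex.norm_natCast]
      push_cast
      linarith [(Nat.cast_nonneg n : (0:ℝ) ≤ n)]
  rw [Polynomial.map_eq_zero] at h2
  exact RatFunc.num_ne_zero hne h2

lemma one_sub_inv {f : TF} (hf : MemRHinfTF f) (hs : StrictlyProperTF f) {c : ℝ} (hc1 : c < 1)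
    (hc : ∀ z : ℂ, ‖z‖ = 1 → ‖evalTF f z‖ ≤ c) :
    1 - f ≠ 0 ∧ MemRHinfTF (1 - f)⁻¹ ∧
      ∀ z : ℂ, ‖z‖ = 1 → ‖evalTF (1 - f)⁻¹ z‖ ≤ (1 - c)⁻¹ := by
  have hv : vInf (1 - f) = 1 := Valuation.map_one_sub_of_lt _ ((sproper_iff f).1 hs)
  have hne : 1 - f ≠ 0 := by
    intro h; rw [h] at hv; simp at hv
  have hev : ∀ z : ℂ, 1 ≤ ‖z‖ → evalTF (1 - f) z ≠ 0 := by
    intro z hz h0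
    have h1 := maxmod hf hc hz
    rw [evalTF_sub rh_one hf hz, evalTF_one, sub_eq_zero] at h0
    rw [← h0] at h1
    simp at h1
    linarith
  have hst : StableTF (1 - f)⁻¹ := by
    refine stable_of_dvd (RatFunc.denom_inv_dvd hne) fun z hz => ?_
    by_contra hlt
    push Not at hlt
    refine hev z hlt ?_
    rw [evalTF_eq, RatFunc.eval, hz, zero_div]
  have hm : MemRHinfTF (1 - f)⁻¹ := by
    refine ⟨?_, hst⟩
    rw [proper_iff, map_inv₀, hv, inv_one]
  refine ⟨hne, hm, fun z hz => ?_⟩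
  have h1 : evalTF ((1 - f) * (1 - f)⁻¹) z = 1 := by rw [mul_inv_cancel₀ hne, evalTF_one]
  rw [evalTF_mul (rh_one.sub hf).2 hst hz.ge, evalTF_sub rh_one hf hz.ge, evalTF_one] at h1
  rw [eq_inv_of_mul_eq_one_right h1, norm_inv]
  have h2 : 1 - c ≤ ‖1 - evalTF f z‖ := by
    have := norm_sub_norm_le 1 (evalTF f z)
    have h3 := hc z hz
    simp at this
    linarith
  exact inv_anti₀ (by linarith) h2

/-! matrices -/

lemma rh_rmap {m n : ℕ} (A : Matrix (Fin m) (Fin n) ℝ) : MemRHinf (rmap A) := fun _ _ => rh_C _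

lemma MemRHinf.add {m n : ℕ} {F G : TMat m n} (hF : MemRHinf F) (hG : MemRHinf G) :
    MemRHinf (F + G) := fun i j => (hF i j).add (hG i j)

lemma MemRHinf.sub {m n : ℕ} {F G : TMat m n} (hF : MemRHinf F) (hG : MemRHinf G) :
    MemRHinf (F - G) := fun i j => (hF i j).sub (hG i j)

lemma MemRHinf.mul {m n k : ℕ} {F : TMat m n} {G : TMat n k} (hF : MemRHinf F)
    (hG : MemRHinf G) : MemRHinf (F * G) := fun i j => by
  rw [Matrix.mul_apply]
  exact rh_sum _ _ fun l _ => (hF i l).mul (hG l j)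

lemma MemRHinf.smul {m n : ℕ} {c : TF} {F : TMat m n} (hc : MemRHinfTF c) (hF : MemRHinf F) :
    MemRHinf (c • F) := fun i j => by
  rw [Matrix.smul_apply, smul_eq_mul]
  exact hc.mul (hF i j)

lemma sp_sum {ι : Type*} (s : Finset ι) (f : ι → TF) (hf : ∀ i ∈ s, StrictlyProperTF (f i)) :
    StrictlyProperTF (∑ i ∈ s, f i) := by
  rw [sproper_iff]
  exact vInf.map_sum_lt one_ne_zero fun i hi => (sproper_iff _).1 (hf i hi)

lemma sp_mul_left {f g : TF} (hf : ProperTF f) (hg : StrictlyProperTF g) :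
    StrictlyProperTF (f * g) := by
  rw [sproper_iff, map_mul]
  exact mul_lt_one_of_nonneg_of_lt_one_right ((proper_iff _).1 hf) zero_le ((sproper_iff _).1 hg)

lemma sp_mul_right {f g : TF} (hf : StrictlyProperTF f) (hg : ProperTF g) :
    StrictlyProperTF (f * g) := by
  rw [mul_comm]; exact sp_mul_left hg hf

lemma StrictlyProper.add {m n : ℕ} {F G : TMat m n} (hF : StrictlyProper F)
    (hG : StrictlyProper G) : StrictlyProper (F + G) := fun i j => by
  rw [sproper_iff]
  exact vInf.map_add_lt ((sproper_iff _).1 (hF i j)) ((sproper_iff _).1 (hG i j))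

lemma StrictlyProper.mul_left {m n k : ℕ} {F : TMat m n} {G : TMat n k} (hF : MemRHinf F)
    (hG : StrictlyProper G) : StrictlyProper (F * G) := fun i j => by
  rw [Matrix.mul_apply]
  exact sp_sum _ _ fun l _ => sp_mul_left (hF i l).1 (hG l j)

lemma StrictlyProper.smul {m n : ℕ} {c : TF} {F : TMat m n} (hc : MemRHinfTF c)
    (hF : StrictlyProper F) : StrictlyProper (c • F) := fun i j => by
  rw [Matrix.smul_apply, smul_eq_mul]
  exact sp_mul_left hc.1 (hF i j)

lemma evalMat_add {m n : ℕ} {F G : TMat m n} (hF : MemRHinf F) (hG : MemRHinf G) {z : ℂ}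
    (hz : ‖z‖ = 1) : evalMat (F + G) z = evalMat F z + evalMat G z := by
  ext i j
  exact evalTF_add (hF i j).2 (hG i j).2 hz.ge

lemma evalMat_mul {m n k : ℕ} {F : TMat m n} {G : TMat n k} (hF : MemRHinf F) (hG : MemRHinf G)
    {z : ℂ} (hz : ‖z‖ = 1) : evalMat (F * G) z = evalMat F z * evalMat G z := by
  ext i j
  rw [Matrix.mul_apply]
  simp only [evalMat, Matrix.of_apply]
  rw [Matrix.mul_apply, evalTF_sum _ _ (fun l _ => (hF i l).mul (hG l j)) hz.ge]
  exact Finset.sum_congr rfl fun l _ => evalTF_mul (hF i l).2 (hG l j).2 hz.ge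

lemma evalMat_smul {m n : ℕ} {c : TF} {F : TMat m n} (hc : MemRHinfTF c) (hF : MemRHinf F)
    {z : ℂ} (hz : ‖z‖ = 1) : evalMat (c • F) z = evalTF c z • evalMat F z := by
  ext i j
  exact evalTF_mul hc.2 (hF i j).2 hz.ge

section norms
open scoped Matrix.Norms.L2Operator

lemma specNorm_eq {m n : ℕ} (M : Matrix (Fin m) (Fin n) ℂ) : specNorm M = ‖M‖ := rfl

lemma specNorm_nonneg {m n : ℕ} (M : Matrix (Fin m) (Fin n) ℂ) : 0 ≤ specNorm M := by
  rw [specNorm_eq]; exact norm_nonneg _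

lemma specNorm_add {m n : ℕ} (M N : Matrix (Fin m) (Fin n) ℂ) :
    specNorm (M + N) ≤ specNorm M + specNorm N := by
  simp only [specNorm_eq]; exact norm_add_le _ _

lemma specNorm_mul {m n k : ℕ} (M : Matrix (Fin m) (Fin n) ℂ) (N : Matrix (Fin n) (Fin k) ℂ) :
    specNorm (M * N) ≤ specNorm M * specNorm N := by
  simp only [specNorm_eq]; exact Matrix.l2_opNorm_mul _ _

lemma specNorm_smul {m n : ℕ} (c : ℂ) (M : Matrix (Fin m) (Fin n) ℂ) :
    specNorm (c • M) = ‖c‖ * specNorm M := by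
  simp only [specNorm_eq]; exact norm_smul _ _

lemma entry_le_specNorm {m n : ℕ} (M : Matrix (Fin m) (Fin n) ℂ) (i : Fin m) (j : Fin n) :
    ‖M i j‖ ≤ specNorm M := by
  have h := Matrix.l2_opNorm_mulVec M (EuclideanSpace.single j (1:ℂ))
  rw [← specNorm_eq] at h
  simp at h
  refine le_trans ?_ h
  have := EuclideanSpace.norm_eq (WithLp.toLp 2 (M.col j) : EuclideanSpace ℂ (Fin m))
  have h2 := PiLp.norm_apply_le (WithLp.toLp 2 (M.col j) : EuclideanSpace ℂ (Fin m)) i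
  simpa using h2

lemma continuous_specNorm {m n : ℕ} :
    Continuous (fun M : Matrix (Fin m) (Fin n) ℂ => specNorm M) := by
  unfold specNorm
  refine continuous_norm.comp ?_
  exact LinearMap.continuous_of_finiteDimensional
    ((LinearMap.toContinuousLinearMap.toLinearMap).comp
      (Matrix.toEuclideanLin (𝕜 := ℂ) (m := Fin m) (n := Fin n)).toLinearMap)

lemma specNorm_row {n : ℕ} (δ : Fin n → ℝ) (z : ℂ) :
    specNorm (evalMat (rmap (rowVec δ)) z) ≤ euclNorm δ := by
  have : evalMat (rmap (rowVec δ)) z = (Matrix.of fun _ j => (δ j : ℂ)) := by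
    ext i j; simp [evalMat, rmap, rowVec]
  rw [this]
  unfold specNorm
  refine ContinuousLinearMap.opNorm_le_bound _ (Real.sqrt_nonneg _) fun x => ?_
  simp only [LinearMap.coe_toContinuousLinearMap']
  rw [EuclideanSpace.norm_eq, EuclideanSpace.norm_eq, euclNorm,
    ← Real.sqrt_mul (Finset.sum_nonneg fun _ _ => sq_nonneg _)]
  refine Real.sqrt_le_sqrt ?_
  simp only [Finset.univ_unique, Finset.sum_singleton, Matrix.toLpLin_apply, Matrix.mulVec,
    dotProduct, Matrix.of_apply]
  have h1 : ‖∑ j, (δ j : ℂ) * x j‖ ≤ ∑ j, |δ j| * ‖x j‖ := by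
    refine (norm_sum_le _ _).trans (Finset.sum_le_sum fun j _ => ?_)
    simp
  calc _ ≤ (∑ j, |δ j| * ‖x j‖) ^ 2 := by gcongr
    _ ≤ _ := by
      have := Finset.sum_mul_sq_le_sq_mul_sq Finset.univ (fun j => |δ j|) (fun j => ‖x j‖)
      simpa using this

end norms

lemma hinf_bdd {m n : ℕ} {F : TMat m n} (hF : MemRHinf F) :
    BddAbove {x : ℝ | ∃ z : ℂ, ‖z‖ = 1 ∧ x = specNorm (evalMat F z)} := by
  have hc : ContinuousOn (fun z => specNorm (evalMat F z)) (Metric.sphere (0:ℂ) 1) := by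
    refine continuous_specNorm.comp_continuousOn ?_
    refine continuousOn_pi.2 fun i => continuousOn_pi.2 fun j => ?_
    refine (continuousOn_evalTF (hF i j).2).mono ?_
    intro z hz
    have : ‖z‖ = 1 := by simpa using hz
    exact this.ge
  have := (isCompact_sphere (0:ℂ) 1).bddAbove_image hc
  refine this.mono ?_
  rintro x ⟨z, hz, rfl⟩
  exact ⟨z, by simpa using hz, rfl⟩

lemma le_hinf {m n : ℕ} {F : TMat m n} (hF : MemRHinf F) {z : ℂ} (hz : ‖z‖ = 1) :
    specNorm (evalMat F z) ≤ hinfNorm F :=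
  le_csSup (hinf_bdd hF) ⟨z, hz, rfl⟩

lemma hinf_le {m n : ℕ} {F : TMat m n} {c : ℝ}
    (h : ∀ z : ℂ, ‖z‖ = 1 → specNorm (evalMat F z) ≤ c) : hinfNorm F ≤ c := by
  refine csSup_le ⟨_, 1, by simp, rfl⟩ ?_
  rintro x ⟨z, hz, rfl⟩
  exact h z hz

lemma hinf_nonneg {m n : ℕ} (F : TMat m n) : 0 ≤ hinfNorm F := by
  refine Real.sSup_nonneg ?_
  rintro x ⟨z, hz, rfl⟩
  exact specNorm_nonneg _

lemma le_hinfTF {f : TF} (hf : MemRHinfTF f) {z : ℂ} (hz : ‖z‖ = 1) :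
    ‖evalTF f z‖ ≤ hinfNormTF f := by
  refine le_csSup ?_ ⟨z, hz, rfl⟩
  have hc : ContinuousOn (fun z => ‖evalTF f z‖) (Metric.sphere (0:ℂ) 1) := by
    refine continuous_norm.comp_continuousOn ((continuousOn_evalTF hf.2).mono ?_)
    intro z hz
    have : ‖z‖ = 1 := by simpa using hz
    exact this.ge
  refine ((isCompact_sphere (0:ℂ) 1).bddAbove_image hc).mono ?_
  rintro x ⟨z, hz, rfl⟩
  exact ⟨z, by simpa using hz, rfl⟩

end SLS

namespace SLS

lemma sMulTF_eq {m n : ℕ} (c : TF) (M : TMat m n) : sMulTF c M = c • M := rfl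

lemma rmap_row_add {n : ℕ} (a δ : Fin n → ℝ) :
    rmap (rowVec (a + δ)) = rmap (rowVec a) + rmap (rowVec δ) := by
  ext i j; simp [rmap, rowVec]

lemma one_by_one (S : TMat 1 1) : S = (S 0 0) • (1 : TMat 1 1) := by
  ext i j
  fin_cases i; fin_cases j; simp

/-- Left block equations for the perturbed response. -/
lemma sm_left {n : ℕ} {Z : TMat n n} {B : TMat n 1} {R : TMat n n} {M : TMat 1 n}
    {N : TMat n 1} {L : TMat 1 1} (D : TMat 1 n) (c : TF)
    (h1 : Z * R - B * M = 1) (h2 : Z * N - B * L = 0) :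
    Z * (R + c • (N * D * R)) - B * (M + c • (L * D * R)) = 1 ∧
    Z * (N + c • (N * D * N)) - B * (L + c • (L * D * N)) = 0 := by
  have h2' : Z * N = B * L := sub_eq_zero.1 h2
  constructor
  · rw [← h1]
    simp only [Matrix.mul_add, Matrix.mul_smul, ← Matrix.mul_assoc, h2']
    abel
  · rw [← h2]
    simp only [Matrix.mul_add, Matrix.mul_smul, ← Matrix.mul_assoc, h2']
    abel

lemma sm_N {n k : ℕ} {N : TMat n 1} {D : TMat 1 n} {Y : TMat k 1} {t c : TF}
    (ht : D * N = t • (1 : TMat 1 1)) (hc : c * (1 - t) = 1) :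
    Y + c • (Y * D * N) = c • Y := by
  rw [Matrix.mul_assoc, ht, Matrix.mul_smul, Matrix.mul_one, smul_smul]
  have : c = 1 + c * t := by linear_combination hc
  conv_rhs => rw [this, add_smul, one_smul]

/-- Right block equations for the perturbed response. -/
lemma sm_right {n : ℕ} {Z : TMat n n} {R : TMat n n} {M : TMat 1 n}
    {N : TMat n 1} {L : TMat 1 1} {a D : TMat 1 n} {t c : TF}
    (ht : D * N = t • (1 : TMat 1 1)) (hc : c * (1 - t) = 1)
    (h1 : R * Z - N * a = 1) (h2 : M * Z - L * a = 0) :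
    (R + c • (N * D * R)) * Z - (N + c • (N * D * N)) * (a + D) = 1 ∧
    (M + c • (L * D * R)) * Z - (L + c • (L * D * N)) * (a + D) = 0 := by
  have h1' : R * Z = 1 + N * a := by rw [← h1]; abel
  have h2' : M * Z = L * a := sub_eq_zero.1 h2
  have hct : c * t = c - 1 := by linear_combination -hc
  rw [sm_N ht hc, sm_N ht hc]
  have e : ∀ {k : ℕ} (Y : TMat k 1), c • (Y * D * R) * Z =
      c • (Y * D) + (c - 1) • (Y * a) := by
    intro k Y
    rw [Matrix.smul_mul, Matrix.mul_assoc, h1', Matrix.mul_add, Matrix.mul_one, smul_add,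
      Matrix.mul_assoc Y D, ← Matrix.mul_assoc D, ht, Matrix.smul_mul, Matrix.one_mul,
      Matrix.mul_smul, smul_smul, hct]
  constructor
  · rw [Matrix.add_mul, e, h1']
    simp only [Matrix.mul_add, Matrix.smul_mul, sub_smul, one_smul]
    abel
  · rw [Matrix.add_mul, e, h2']
    simp only [Matrix.mul_add, Matrix.smul_mul, sub_smul, one_smul]
    abel

/-- The controller identities. -/
lemma ctrl_id {n : ℕ} {Z : TMat n n} {R : TMat n n} {M : TMat 1 n}
    {N : TMat n 1} {L : TMat 1 1} {a : TMat 1 n} (hR : IsUnit R.det)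
    (h1 : R * Z - N * a = 1) (h2 : M * Z - L * a = 0) :
    (L - M * R⁻¹ * N) * a * R = M ∧ (L - M * R⁻¹ * N) * a * N + (L - M * R⁻¹ * N) = L := by
  have h1' : N * a = R * Z - 1 := by rw [← h1]; abel
  have h2' : L * a = M * Z := (sub_eq_zero.1 h2).symm
  have hRi : R⁻¹ * R = 1 := Matrix.nonsing_inv_mul R hR
  have h3 : (L - M * R⁻¹ * N) * a = M * R⁻¹ := by
    rw [Matrix.sub_mul, h2', Matrix.mul_assoc, h1', Matrix.mul_sub, Matrix.mul_one,
      Matrix.mul_assoc M, ← Matrix.mul_assoc R⁻¹, hRi, Matrix.one_mul]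
    abel
  rw [h3]
  constructor
  · rw [Matrix.mul_assoc, hRi, Matrix.mul_one]
  · abel

lemma sm_ctrl {n : ℕ} {R : TMat n n} {M : TMat 1 n}
    {N : TMat n 1} {L K : TMat 1 1} {a D : TMat 1 n} {t c : TF}
    (ht : D * N = t • (1 : TMat 1 1)) (hc : c * (1 - t) = 1)
    (h1 : K * a * R = M) (h2 : K * a * N + K = L) :
    M + c • (L * D * R) = K * (a + D) * (R + c • (N * D * R)) ∧
    L + c • (L * D * N) = K * (a + D) * (N + c • (N * D * N)) + K := by
  have hct : c * t = c - 1 := by linear_combination -hc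
  constructor
  · rw [← h1, ← h2]
    simp only [Matrix.mul_add, Matrix.add_mul, Matrix.mul_smul, smul_add]
    have : K * D * (N * D * R) = t • (K * D * R) := by
      rw [Matrix.mul_assoc N, ← Matrix.mul_assoc (K * D), Matrix.mul_assoc K D N, ht,
        Matrix.mul_smul, Matrix.mul_one, Matrix.smul_mul, ← Matrix.mul_assoc]
    rw [this, smul_smul, hct, sub_smul, one_smul]
    simp only [Matrix.mul_assoc]
    abel
  · rw [sm_N ht hc, sm_N ht hc, ← h2]
    simp only [Matrix.mul_add, Matrix.add_mul, Matrix.mul_smul, smul_add]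
    rw [Matrix.mul_assoc K D N, ht, Matrix.mul_smul, Matrix.mul_one, smul_smul, hct, sub_smul,
      one_smul]
    abel

/-- Invertibility of `1 + S` with `S` strictly proper. -/
lemma isUnit_one_add {n : ℕ} {S : TMat n n} (hS : StrictlyProper S) : IsUnit (1 + S).det := by
  rw [isUnit_iff_ne_zero]
  intro h0
  obtain ⟨v, hv, hv0⟩ := Matrix.exists_mulVec_eq_zero_iff.2 h0
  obtain ⟨j, hj⟩ := Function.ne_iff.1 hv
  have : Nonempty (Fin n) := ⟨j⟩
  obtain ⟨i, hi⟩ := Finite.exists_max (fun i => vInf (v i))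
  have hpos : vInf (v i) ≠ 0 := by
    intro h
    have := hi j
    rw [h] at this
    exact hj (by simpa using this)
  have h1 : v i = - ∑ k, S i k * v k := by
    have := congrFun hv0 i
    rw [Matrix.add_mulVec, Matrix.one_mulVec] at this
    simp only [Pi.add_apply, Matrix.mulVec, dotProduct, Pi.zero_apply] at this
    exact eq_neg_of_add_eq_zero_left this
  have h2 : vInf (v i) < vInf (v i) := by
    conv_lhs => rw [h1, Valuation.map_neg]
    refine vInf.map_sum_lt hpos fun k _ => ?_
    rw [map_mul]
    have hs := (sproper_iff _).1 (hS i k)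
    calc vInf (S i k) * vInf (v k) ≤ vInf (S i k) * vInf (v i) := by gcongr; exact hi k
      _ < 1 * vInf (v i) := by
        exact mul_lt_mul_of_pos_right hs (zero_lt_iff.2 hpos)
      _ = _ := one_mul _
  exact lt_irrefl _ h2

lemma isUnit_R {n : ℕ} {A : Matrix (Fin n) (Fin n) ℝ} {B : Matrix (Fin n) (Fin 1) ℝ}
    {R : TMat n n} {M : TMat 1 n} (h : zIA A * R - rmap B * M = 1)
    (hR : StrictlyProper R) (hM : StrictlyProper M) : IsUnit R.det := by
  have h1 : (RatFunc.X : TF) • R = 1 + (rmap A * R + rmap B * M) := by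
    rw [← h, zIA, Matrix.sub_mul]
    have : Matrix.diagonal (fun _ => (RatFunc.X : TF)) * R = (RatFunc.X : TF) • R := by
      rw [← Matrix.smul_one_eq_diagonal, Matrix.smul_mul, Matrix.one_mul]
    rw [this]
    abel
  have h2 := isUnit_one_add
    ((StrictlyProper.mul_left (rh_rmap A) hR).add (StrictlyProper.mul_left (rh_rmap B) hM))
  rw [← h1, Matrix.det_smul] at h2
  exact (IsUnit.mul_iff.1 h2).2

end SLS

namespace SLS

/-- First basis column. -/
def E0 : Matrix (Fin 2) (Fin 1) ℝ := Matrix.of fun i _ => if (i : ℕ) = 0 then 1 else 0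

lemma rmap_C1 {n : ℕ} (g : Fin n → ℝ) : rmap (C1mat g) = rmap E0 * rmap (rowVec g) := by
  ext i j
  fin_cases i <;> simp [rmap, C1mat, E0, rowVec, Matrix.mul_apply]

lemma col2_eq (S L : TMat 1 1) : col2 (S 0 0) (L 0 0) = rmap E0 * S + rmap D12mat * L := by
  ext i j
  fin_cases j
  fin_cases i <;> simp [rmap, col2, E0, D12mat, Matrix.mul_apply]

/-- The closed loop map inside the cost. -/
def Pmap {n nw : ℕ} (g : Fin n → ℝ) (B₁ : Matrix (Fin n) (Fin nw) ℝ)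
    (D₂₁ : Matrix (Fin 1) (Fin nw) ℝ) (D₁₁ : Matrix (Fin 2) (Fin nw) ℝ)
    (Θ : Response n 1 1) : TMat 2 nw :=
  (rmap (C1mat g) * Θ.R + rmap D12mat * Θ.M) * rmap B₁ +
    (rmap (C1mat g) * Θ.N + rmap D12mat * Θ.L) * rmap D₂₁ + rmap D₁₁

lemma rh_Pmap {n nw : ℕ} (g : Fin n → ℝ) (B₁ : Matrix (Fin n) (Fin nw) ℝ)
    (D₂₁ : Matrix (Fin 1) (Fin nw) ℝ) (D₁₁ : Matrix (Fin 2) (Fin nw) ℝ)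
    {Θ : Response n 1 1} (h : SLSStable Θ) : MemRHinf (Pmap g B₁ D₂₁ D₁₁ Θ) := by
  obtain ⟨-, -, -, hR, hM, hN, hL⟩ := h
  exact (((((rh_rmap _).mul hR).add ((rh_rmap _).mul hM)).mul (rh_rmap _)).add
    ((((rh_rmap _).mul hN).add ((rh_rmap _).mul hL)).mul (rh_rmap _))).add (rh_rmap _)

lemma P_alg {n nw : ℕ} {a D : TMat 1 n} {R : TMat n n} {M : TMat 1 n} {N : TMat n 1}
    {L : TMat 1 1} {E F : TMat 2 1} {B : TMat n nw} {D2 : TMat 1 nw} {t c : TF}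
    (ht : D * N = t • (1 : TMat 1 1)) (hc : c * (1 - t) = 1) :
    (E * (a + D) * (R + c • (N * D * R)) + F * (M + c • (L * D * R))) * B +
    (E * (a + D) * (N + c • (N * D * N)) + F * (L + c • (L * D * N))) * D2 =
    ((E * a * R + F * M) * B + (E * a * N + F * L) * D2) +
      c • ((E * (1 + a * N) + F * L) * (D * (R * B + N * D2))) := by
  have hct : c * t = c - 1 := by linear_combination -hc
  have e : ∀ {k : ℕ} (Y : TMat n k), E * D * (N * D * Y) = t • (E * D * Y) := by
    intro k Y
    rw [Matrix.mul_assoc N, ← Matrix.mul_assoc (E * D), Matrix.mul_assoc E D N, ht,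
        Matrix.mul_smul, Matrix.mul_one, Matrix.smul_mul, ← Matrix.mul_assoc]
  simp only [Matrix.mul_add, Matrix.add_mul, Matrix.mul_smul, Matrix.smul_mul, smul_add, e,
    smul_smul, hct, sub_smul, one_smul, Matrix.mul_one, Matrix.sub_mul]
  simp only [Matrix.mul_assoc]
  abel

lemma W_alg {n nw : ℕ} {D : TMat 1 n} {R : TMat n n} {N : TMat n 1}
    {B : TMat n nw} {D2 : TMat 1 nw} {c : TF} :
    (R + c • (N * D * R)) * B + (N + c • (N * D * N)) * D2 =
    (R * B + N * D2) + c • (N * (D * (R * B + N * D2))) := by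
  simp only [Matrix.mul_add, Matrix.add_mul, Matrix.smul_mul, smul_add]
  simp only [Matrix.mul_assoc]
  abel

lemma pw_mat {n : ℕ} (g : Fin n → ℝ) (Θ : Response n 1 1) :
    col2 (1 + (rmap (rowVec g) * Θ.N) 0 0) (Θ.L 0 0) =
      rmap E0 * (1 + rmap (rowVec g) * Θ.N) + rmap D12mat * Θ.L := by
  rw [← col2_eq]; simp

lemma rh_pw {n : ℕ} (g : Fin n → ℝ) {Θ : Response n 1 1} (h : SLSStable Θ) :
    MemRHinf (col2 (1 + (rmap (rowVec g) * Θ.N) 0 0) (Θ.L 0 0)) := by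
  obtain ⟨-, -, -, hR, hM, hN, hL⟩ := h
  intro i j
  have h1 : MemRHinfTF (1 + (rmap (rowVec g) * Θ.N) 0 0) :=
    rh_one.add (((rh_rmap _).mul hN) 0 0)
  simp only [col2, Matrix.of_apply]
  split_ifs
  · exact h1
  · exact hL 0 0

lemma pw_pos {n : ℕ} (g : Fin n → ℝ) {Θ : Response n 1 1} (h : SLSStable Θ) :
    0 < perfWeight g Θ := by
  refine lt_of_le_of_ne (hinf_nonneg _) fun h0 => ?_
  have hsp : StrictlyProperTF ((rmap (rowVec g) * Θ.N) 0 0) :=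
    StrictlyProper.mul_left (rh_rmap _) h.2.2.1 0 0
  have h1 : 1 + (rmap (rowVec g) * Θ.N) 0 0 = 0 := by
    refine eq_zero_of_circle (rh_one.add (((rh_rmap _).mul h.2.2.2.2.2.1) 0 0)) fun z hz => ?_
    have h2 := (entry_le_specNorm _ 0 0).trans (le_hinf (rh_pw g h) hz)
    rw [perfWeight] at h0
    rw [← h0] at h2
    simpa [evalMat, col2] using h2
  have h2 : vInf (1 + (rmap (rowVec g) * Θ.N) 0 0) = 1 :=
    Valuation.map_one_add_of_lt _ ((sproper_iff _).1 hsp)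
  rw [h1] at h2
  simp at h2

lemma perturb {n nw : ℕ} {A : Matrix (Fin n) (Fin n) ℝ} {B : Matrix (Fin n) (Fin 1) ℝ}
    (a δ : Fin n → ℝ) (B₁ : Matrix (Fin n) (Fin nw) ℝ)
    (D₂₁ : Matrix (Fin 1) (Fin nw) ℝ) (D₁₁ : Matrix (Fin 2) (Fin nw) ℝ)
    (ε : ℝ) {Θ : Response n 1 1} (hΘ : SLSConstraints A B (rowVec a) Θ)
    (hδ : euclNorm δ ≤ ε) (hx : ε * hinfNorm Θ.N < 1) :
    ∃ Θ' : Response n 1 1, SLSConstraints A B (rowVec (a + δ)) Θ' ∧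
      Achieves A B (rowVec (a + δ)) (controller Θ) Θ' ∧
      cost (a + δ) B₁ D₂₁ D₁₁ Θ' ≤ cost a B₁ D₂₁ D₁₁ Θ +
        (1 - ε * hinfNorm Θ.N)⁻¹ * (perfWeight a Θ *
          (ε * hinfNorm (Θ.R * rmap B₁ + Θ.N * rmap D₂₁))) ∧
      hinfNorm Θ'.N ≤ (1 - ε * hinfNorm Θ.N)⁻¹ * hinfNorm Θ.N ∧
      perfWeight (a + δ) Θ' ≤ (1 - ε * hinfNorm Θ.N)⁻¹ * perfWeight a Θ ∧
      hinfNorm (Θ'.R * rmap B₁ + Θ'.N * rmap D₂₁) ≤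
        (1 - ε * hinfNorm Θ.N)⁻¹ * hinfNorm (Θ.R * rmap B₁ + Θ.N * rmap D₂₁) := by
  obtain ⟨h1, h2, h3, h4, hst⟩ := hΘ
  obtain ⟨sR, sM, sN, rR, rM, rN, rL⟩ := id hst
  have hε : 0 ≤ ε := (Real.sqrt_nonneg _).trans hδ
  set x := ε * hinfNorm Θ.N with hxdef
  set D := rmap (rowVec δ) with hD
  have rD : MemRHinf D := rh_rmap _
  set t := (D * Θ.N) 0 0 with htdef
  have ht : D * Θ.N = t • (1 : TMat 1 1) := one_by_one _
  have rt : MemRHinfTF t := (rD.mul rN) 0 0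
  have st : StrictlyProperTF t := StrictlyProper.mul_left rD sN 0 0
  have hDz : ∀ z, specNorm (evalMat D z) ≤ ε := fun z => (specNorm_row δ z).trans hδ
  have htx : ∀ z : ℂ, ‖z‖ = 1 → ‖evalTF t z‖ ≤ x := by
    intro z hz
    have h := entry_le_specNorm (evalMat (D * Θ.N) z) 0 0
    rw [evalMat_mul rD rN hz] at h
    have h5 : ‖evalTF t z‖ ≤ specNorm (evalMat D z * evalMat Θ.N z) := by
      rw [← evalMat_mul rD rN hz] at h ⊢
      exact h
    refine h5.trans ((specNorm_mul _ _).trans ?_)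
    exact mul_le_mul (hDz z) (le_hinf rN hz) (specNorm_nonneg _) hε
  obtain ⟨hne, rc, hcz⟩ := one_sub_inv rt st hx htx
  set c := (1 - t)⁻¹ with hcdef
  have hc : c * (1 - t) = 1 := inv_mul_cancel₀ hne
  have hy : 0 < (1 - x)⁻¹ := inv_pos.2 (by linarith)
  have hyx : 1 + (1 - x)⁻¹ * x = (1 - x)⁻¹ := by
    have : 1 - x ≠ 0 := by linarith
    field_simp
    ring
  have hb : rmap (rowVec (a + δ)) = rmap (rowVec a) + D := rmap_row_add a δ
  have rNDR : MemRHinf (c • (Θ.N * D * Θ.R)) := MemRHinf.smul rc ((rN.mul rD).mul rR)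
  let Θ' : Response n 1 1 :=
    { R := Θ.R + c • (Θ.N * D * Θ.R)
      M := Θ.M + c • (Θ.L * D * Θ.R)
      N := Θ.N + c • (Θ.N * D * Θ.N)
      L := Θ.L + c • (Θ.L * D * Θ.N) }
  have hN' : Θ'.N = c • Θ.N := sm_N ht hc
  have hL' : Θ'.L = c • Θ.L := sm_N ht hc
  have hst' : SLSStable Θ' := by
    refine ⟨sR.add (StrictlyProper.smul rc (StrictlyProper.mul_left (rN.mul rD) sR)),
      sM.add (StrictlyProper.smul rc (StrictlyProper.mul_left (rL.mul rD) sR)), ?_,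
      rR.add rNDR, rM.add (MemRHinf.smul rc ((rL.mul rD).mul rR)), ?_, ?_⟩
    · rw [hN']; exact StrictlyProper.smul rc sN
    · rw [hN']; exact MemRHinf.smul rc rN
    · rw [hL']; exact MemRHinf.smul rc rL
  obtain ⟨l1, l2⟩ := sm_left (c := c) D h1 h2
  obtain ⟨r1, r2⟩ := sm_right ht hc h3 h4
  obtain ⟨k1, k2⟩ := ctrl_id (isUnit_R h1 sR sM) h3 h4
  obtain ⟨m1, m2⟩ := sm_ctrl ht hc k1 k2
  set W := Θ.R * rmap B₁ + Θ.N * rmap D₂₁ with hW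
  have rW : MemRHinf W := (rR.mul (rh_rmap _)).add (rN.mul (rh_rmap _))
  have hDW : ∀ z : ℂ, ‖z‖ = 1 → specNorm (evalMat (D * W) z) ≤ ε * hinfNorm W := by
    intro z hz
    rw [evalMat_mul rD rW hz]
    exact (specNorm_mul _ _).trans
      (mul_le_mul (hDz z) (le_hinf rW hz) (specNorm_nonneg _) hε)
  refine ⟨Θ', ⟨l1, l2, ?_, ?_, hst'⟩, ⟨?_, ?_, ?_, ?_⟩, ?_, ?_, ?_, ?_⟩
  · rw [hb]; exact r1
  · rw [hb]; exact r2
  · rw [← l1]; simp [Θ']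
  · exact sub_eq_zero.1 l2
  · rw [hb]; exact m1
  · rw [hb]; exact m2
  · have hP : Pmap (a + δ) B₁ D₂₁ D₁₁ Θ' = Pmap a B₁ D₂₁ D₁₁ Θ +
        c • (col2 (1 + (rmap (rowVec a) * Θ.N) 0 0) (Θ.L 0 0) * (D * W)) := by
      unfold Pmap
      rw [rmap_C1, rmap_C1, hb, pw_mat]
      have h := P_alg (a := rmap (rowVec a)) (R := Θ.R) (M := Θ.M) (L := Θ.L) (E := rmap E0)
        (F := rmap D12mat) (B := rmap B₁) (D2 := rmap D₂₁) ht hc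
      rw [add_right_comm _ (rmap D₁₁) (c • _)]
      exact congrArg (· + rmap D₁₁) h
    refine hinf_le fun z hz => ?_
    change specNorm (evalMat (Pmap (a + δ) B₁ D₂₁ D₁₁ Θ') z) ≤ _
    have rq := (rh_pw a hst).mul (rD.mul rW)
    rw [hP, evalMat_add (rh_Pmap _ _ _ _ hst) (MemRHinf.smul rc rq) hz, evalMat_smul rc rq hz,
      evalMat_mul (rh_pw a hst) (rD.mul rW) hz]
    refine (specNorm_add _ _).trans (add_le_add (le_hinf (rh_Pmap _ _ _ _ hst) hz) ?_)
    rw [specNorm_smul]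
    refine mul_le_mul (hcz z hz) ((specNorm_mul _ _).trans ?_) (specNorm_nonneg _) hy.le
    exact mul_le_mul (le_hinf (rh_pw a hst) hz) (hDW z hz) (specNorm_nonneg _) (hinf_nonneg _)
  · rw [hN']
    refine hinf_le fun z hz => ?_
    rw [evalMat_smul rc rN hz, specNorm_smul]
    exact mul_le_mul (hcz z hz) (le_hinf rN hz) (specNorm_nonneg _) hy.le
  · have hcol : col2 (1 + (rmap (rowVec (a + δ)) * Θ'.N) 0 0) (Θ'.L 0 0) =
        c • col2 (1 + (rmap (rowVec a) * Θ.N) 0 0) (Θ.L 0 0) := by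
      rw [pw_mat, pw_mat, hb, hN', hL']
      have : (1 : TMat 1 1) + (rmap (rowVec a) + D) * c • Θ.N =
          c • (1 + rmap (rowVec a) * Θ.N) := by
        rw [Matrix.mul_smul, Matrix.add_mul, ht, smul_add, smul_add, smul_smul]
        have hct : c * t = c - 1 := by linear_combination -hc
        rw [hct, sub_smul, one_smul]
        abel
      rw [this, Matrix.mul_smul, Matrix.mul_smul, smul_add]
    unfold perfWeight
    rw [hcol]
    refine hinf_le fun z hz => ?_
    rw [evalMat_smul rc (rh_pw a hst) hz, specNorm_smul]
    exact mul_le_mul (hcz z hz) (le_hinf (rh_pw a hst) hz) (specNorm_nonneg _) hy.le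
  · have hW' : Θ'.R * rmap B₁ + Θ'.N * rmap D₂₁ = W + c • (Θ.N * (D * W)) := W_alg
    rw [hW']
    refine hinf_le fun z hz => ?_
    have rq := rN.mul (rD.mul rW)
    rw [evalMat_add rW (MemRHinf.smul rc rq) hz, evalMat_smul rc rq hz,
      evalMat_mul rN (rD.mul rW) hz]
    refine (specNorm_add _ _).trans ?_
    rw [specNorm_smul]
    have e1 := le_hinf rW hz
    have e2 : ‖evalTF c z‖ * specNorm (evalMat Θ.N z * evalMat (D * W) z) ≤
        (1 - x)⁻¹ * (hinfNorm Θ.N * (ε * hinfNorm W)) := by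
      refine mul_le_mul (hcz z hz) ((specNorm_mul _ _).trans ?_) (specNorm_nonneg _) hy.le
      exact mul_le_mul (le_hinf rN hz) (hDW z hz) (specNorm_nonneg _) (hinf_nonneg _)
    calc _ ≤ hinfNorm W + (1 - x)⁻¹ * (hinfNorm Θ.N * (ε * hinfNorm W)) := add_le_add e1 e2
      _ = (1 + (1 - x)⁻¹ * x) * hinfNorm W := by rw [hxdef]; ring
      _ = _ := by rw [hyx]

lemma arith1 {ε p0 x nn n0 pn : ℝ} (hε : 0 ≤ ε) (hp : 0 ≤ p0) (hx : x = ε * n0)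
    (hx1 : x < 1 / 2) (hn : nn ≤ (1 - x)⁻¹ * n0) (hpn : pn ≤ (1 - x)⁻¹ * p0) :
    ε * (p0 / (1 - 2 * x)) * nn + pn ≤ p0 / (1 - 2 * x) := by
  have a0 : 0 < 1 - 2 * x := by linarith
  have e1 : ε * (p0 / (1 - 2 * x)) * nn ≤ ε * (p0 / (1 - 2 * x)) * ((1 - x)⁻¹ * n0) :=
    mul_le_mul_of_nonneg_left hn (mul_nonneg hε (div_nonneg hp a0.le))
  refine (add_le_add e1 hpn).trans (le_of_eq ?_)
  have a1 : 1 - x ≠ 0 := by linarith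
  have a2 : 1 - 2 * x ≠ 0 := a0.ne'
  have : ε * (p0 / (1 - 2 * x)) * ((1 - x)⁻¹ * n0) =
    x * (p0 / (1 - 2 * x)) * (1 - x)⁻¹ := by rw [hx]; ring
  rw [this, div_eq_mul_inv]
  have hu := inv_mul_cancel₀ a1
  have hy := inv_mul_cancel₀ a2
  linear_combination (-(1 - x)⁻¹ * p0) * hy + (p0 * (1 - 2 * x)⁻¹) * hu

lemma arith2 {ε α wt nt pt : ℝ} (hε : 0 ≤ ε) (hw : 0 ≤ wt) (hx1 : ε * nt < 1)
    (hfeas : ε * α * nt + pt ≤ α) :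
    (1 - ε * nt)⁻¹ * (pt * (ε * wt)) ≤ ε * α * wt := by
  have : (1 - ε * nt)⁻¹ * pt ≤ α := by
    rw [inv_mul_le_iff₀ (by linarith)]
    linarith
  calc _ = ((1 - ε * nt)⁻¹ * pt) * (ε * wt) := by ring
    _ ≤ α * (ε * wt) := mul_le_mul_of_nonneg_right this (mul_nonneg hε hw)
    _ = _ := by ring

lemma arith3 {ε p0 x w0 wn : ℝ} (hε : 0 ≤ ε) (hp : 0 ≤ p0) (hw : 0 ≤ w0) (_hx0 : 0 ≤ x)
    (hx : x < 1 / 4) (hwn : wn ≤ (1 - x)⁻¹ * w0) :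
    (1 - x)⁻¹ * (p0 * (ε * w0)) + ε * (p0 / (1 - 2 * x)) * wn ≤ 4 * ε * p0 * w0 := by
  have a0 : 0 < 1 - 2 * x := by linarith
  have a1 : 1 - x ≠ 0 := by linarith
  have a2 : 1 - 2 * x ≠ 0 := a0.ne'
  have e2 : ε * (p0 / (1 - 2 * x)) * wn ≤ ε * (p0 / (1 - 2 * x)) * ((1 - x)⁻¹ * w0) :=
    mul_le_mul_of_nonneg_left hwn (mul_nonneg hε (div_nonneg hp a0.le))
  refine (add_le_add le_rfl e2).trans ?_
  have : (1 - x)⁻¹ * (p0 * (ε * w0)) + ε * (p0 / (1 - 2 * x)) * ((1 - x)⁻¹ * w0) =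
      (2 / (1 - 2 * x)) * (ε * p0 * w0) := by
    have hu := inv_mul_cancel₀ a1
    have hy := inv_mul_cancel₀ a2
    rw [div_eq_mul_inv, div_eq_mul_inv]
    linear_combination (2 * (1 - 2 * x)⁻¹ * (ε * p0 * w0)) * hu - (1 - x)⁻¹ * (ε * p0 * w0) * hy
  rw [this]
  have h2 : 2 / (1 - 2 * x) ≤ 4 := by
    rw [div_le_iff₀ (by linarith)]; linarith
  calc _ ≤ 4 * (ε * p0 * w0) :=
        mul_le_mul_of_nonneg_right h2 (mul_nonneg (mul_nonneg hε hp) hw)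
    _ = _ := by ring

/-- The deterministic part. -/
lemma deterministic {n nw : ℕ} (g g' : Fin n → ℝ) (B₁ : Matrix (Fin n) (Fin nw) ℝ)
    (D₂₁ : Matrix (Fin 1) (Fin nw) ℝ) (D₁₁ : Matrix (Fin 2) (Fin nw) ℝ) (ε : ℝ)
    (Θ₀ Θt : Response n 1 1) (α : ℝ) (hΘ₀ : OptimalResponse g B₁ D₂₁ D₁₁ Θ₀)
    (hopt : RobustOptimal g' B₁ D₂₁ D₁₁ ε Θt α)
    (hε : ε * hinfNorm Θ₀.N < 1 / 4) (hδ : euclNorm (g' - g) ≤ ε) :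
    ∃ Θhat : Response n 1 1,
      Achieves (shiftMat n) (e1 n) (rowVec g) (controller Θt) Θhat ∧ SLSStable Θhat ∧
      cost g B₁ D₂₁ D₁₁ Θhat - cost g B₁ D₂₁ D₁₁ Θ₀ ≤
        4 * ε * perfWeight g Θ₀ * hinfNorm (Θ₀.R * rmap B₁ + Θ₀.N * rmap D₂₁) := by
  have hε0 : 0 ≤ ε := (Real.sqrt_nonneg _).trans hδ
  obtain ⟨⟨hα, hSt, hfeas⟩, hmin⟩ := hopt
  have hpw := pw_pos g' hSt.2.2.2.2
  have hx1 : ε * hinfNorm Θt.N < 1 := by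
    by_contra hcon
    push Not at hcon
    nlinarith
  have hδ' : euclNorm (g - g') ≤ ε := by
    have : euclNorm (g - g') = euclNorm (g' - g) := by
      unfold euclNorm
      congr 1
      refine Finset.sum_congr rfl fun i _ => ?_
      simp only [Pi.sub_apply]; ring
    rw [this]; exact hδ
  obtain ⟨Θh, hh1, hh2, hh3, -, -, -⟩ := perturb g' (g - g') B₁ D₂₁ D₁₁ ε hSt hδ' hx1
  obtain ⟨Θn, hn1, -, hn3, hn4, hn5, hn6⟩ :=
    perturb g (g' - g) B₁ D₂₁ D₁₁ ε hΘ₀.1 hδ (by linarith)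
  rw [add_sub_cancel] at hh1 hh2 hh3 hn1 hn3 hn5
  refine ⟨Θh, hh2, hh1.2.2.2.2, ?_⟩
  have hp0 := pw_pos g hΘ₀.1.2.2.2.2
  set x := ε * hinfNorm Θ₀.N with hx
  have hx0 : 0 ≤ x := mul_nonneg hε0 (hinf_nonneg _)
  set w0 := hinfNorm (Θ₀.R * rmap B₁ + Θ₀.N * rmap D₂₁) with hw0
  have hw0' : 0 ≤ w0 := hinf_nonneg _
  set p0 := perfWeight g Θ₀ with hp0def
  have hα' : 0 < p0 / (1 - 2 * x) := div_pos hp0 (by linarith)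
  have hf : RobustFeasible g' ε Θn (p0 / (1 - 2 * x)) := by
    refine ⟨hα', hn1, ?_⟩
    exact arith1 hε0 hp0.le hx (by linarith) hn4 hn5
  have hQ := hmin Θn _ hf
  unfold Qval at hQ
  set wt := hinfNorm (Θt.R * rmap B₁ + Θt.N * rmap D₂₁) with hwt
  have hwt0 : 0 ≤ wt := hinf_nonneg _
  have e1 := arith2 hε0 hwt0 hx1 hfeas
  have e2 := arith3 hε0 hp0.le hw0' hx0 hε hn6
  linarith

end SLS

namespace SLS

/-- The complex polynomial with coefficients `q`. -/
def vecPoly {T : ℕ} (q : Fin T → ℝ) : ℂ[X] :=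
  ∑ k : Fin T, Polynomial.C ((q k : ℝ) : ℂ) * Polynomial.X ^ (k : ℕ)

lemma vecPoly_coeff {T : ℕ} (q : Fin T → ℝ) (n : ℕ) :
    (vecPoly q).coeff n = if h : n < T then ((q ⟨n, h⟩ : ℝ) : ℂ) else 0 := by
  unfold vecPoly
  simp only [Polynomial.finsetSum_coeff, Polynomial.coeff_C_mul, Polynomial.coeff_X_pow]
  split_ifs with h
  · rw [Finset.sum_eq_single ⟨n, h⟩]
    · simp
    · intro b _ hb
      have : n ≠ (b : ℕ) := fun e => hb (Fin.ext e.symm)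
      simp [this]
    · simp
  · apply Finset.sum_eq_zero
    intro b _
    have : n ≠ (b : ℕ) := by have := b.isLt; omega
    simp [this]

lemma parseval_le (p : ℂ[X]) (T : ℕ) :
    ∑ i : Fin T, ‖p.coeff i‖ ^ 2 ≤ Real.circleAverage (fun θ ↦ ‖p.eval θ‖ ^ 2) 0 1 := by
  rw [← Polynomial.sum_sq_norm_coeff_eq_circleAverage,
    Fin.sum_univ_eq_sum_range (fun i => ‖p.coeff i‖ ^ 2) T]
  have h : ∑ i ∈ p.support, ‖p.coeff i‖ ^ 2 = ∑ i ∈ p.support ∪ Finset.range T, ‖p.coeff i‖ ^ 2 := by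
    apply Finset.sum_subset Finset.subset_union_left
    intro x _ hx
    simp [Polynomial.notMem_support_iff.mp hx]
  rw [h]
  exact Finset.sum_le_sum_of_subset_of_nonneg Finset.subset_union_right
    (fun _ _ _ => by positivity)

lemma parseval_vecPoly {T : ℕ} (a : Fin T → ℝ) :
    Real.circleAverage (fun θ ↦ ‖(vecPoly a).eval θ‖ ^ 2) 0 1 = ∑ i, a i ^ 2 := by
  rw [← Polynomial.sum_sq_norm_coeff_eq_circleAverage]
  have h1 : ∑ i, a i ^ 2 = ∑ i ∈ Finset.range T, ‖(vecPoly a).coeff i‖ ^ 2 := by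
    rw [← Fin.sum_univ_eq_sum_range (fun i => ‖(vecPoly a).coeff i‖ ^ 2) T]
    apply Finset.sum_congr rfl
    intro i _
    simp [vecPoly_coeff]
  rw [h1]
  apply Finset.sum_subset
  · intro i hi
    rw [Polynomial.mem_support_iff, vecPoly_coeff] at hi
    by_contra h
    simp at h
    apply hi
    rw [dif_neg (by omega)]
  · intro x _ hx
    simp [Polynomial.notMem_support_iff.mp hx]

lemma toep_mulVec_coeff {T : ℕ} (q a : Fin T → ℝ) (i : Fin T) :
    (((toep q).mulVec a i : ℝ) : ℂ) = (vecPoly a * vecPoly q).coeff i := by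
  conv_rhs => rw [vecPoly, Finset.sum_mul, Polynomial.finsetSum_coeff]
  simp only [Matrix.mulVec, dotProduct, Complex.ofReal_sum]
  apply Finset.sum_congr rfl
  intro j _
  rw [mul_assoc, Polynomial.coeff_C_mul, Polynomial.coeff_X_pow_mul', toep, Matrix.of_apply]
  split_ifs with h
  · rw [vecPoly_coeff, dif_pos (lt_of_le_of_lt (Nat.sub_le _ _) i.isLt)]
    push_cast; ring
  · simp

lemma toep_bound {T : ℕ} (q a : Fin T → ℝ) (H : ℝ)
    (hq : ∀ z : ℂ, ‖z‖ = 1 → ‖(vecPoly q).eval z‖ ≤ H) :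
    ∑ i, ((toep q).mulVec a i) ^ 2 ≤ H ^ 2 * ∑ i, a i ^ 2 := by
  have h1 : ∑ i, ((toep q).mulVec a i) ^ 2 = ∑ i : Fin T, ‖(vecPoly a * vecPoly q).coeff i‖ ^ 2 := by
    apply Finset.sum_congr rfl
    intro i _
    rw [← toep_mulVec_coeff]; simp
  rw [h1]
  refine (parseval_le _ T).trans ?_
  rw [← parseval_vecPoly a]
  have h2 : H ^ 2 * Real.circleAverage (fun θ ↦ ‖(vecPoly a).eval θ‖ ^ 2) 0 1 =
     Real.circleAverage (fun θ ↦ H ^ 2 • ‖(vecPoly a).eval θ‖ ^ 2) 0 1 := by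
    rw [Real.circleAverage_fun_smul]; simp
  rw [h2]
  have cont : ∀ p : ℂ[X], Continuous fun θ : ℂ => ‖p.eval θ‖ ^ 2 := by
    intro p
    exact (p.continuous.norm).pow 2
  apply Real.circleAverage_mono
  · exact (cont _).continuousOn.circleIntegrable'
  · exact ((cont _).const_smul (H ^ 2)).continuousOn.circleIntegrable'
  · intro z hz
    have hz' : ‖z‖ = 1 := by simpa using hz
    have := hq z hz'
    rw [Polynomial.eval_mul, norm_mul, mul_pow, smul_eq_mul, mul_comm]
    gcongr

lemma toepT_bound {T : ℕ} (q a : Fin T → ℝ) (H : ℝ) 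
    (hq : ∀ z : ℂ, ‖z‖ = 1 → ‖(vecPoly q).eval z‖ ≤ H) :
    ∑ i, (Matrix.vecMul a (toep q) i) ^ 2 ≤ H ^ 2 * ∑ i, a i ^ 2 := by
  set b := Matrix.vecMul a (toep q) with hb
  have h1 : ∑ i, b i ^ 2 = ∑ i, a i * (toep q).mulVec b i := by
    have := Matrix.dotProduct_mulVec a (toep q) b
    rw [← hb] at this
    simp only [dotProduct] at this
    rw [this]
    exact Finset.sum_congr rfl fun i _ => by ring
  have h2 : (∑ i, a i * (toep q).mulVec b i) ^ 2 ≤ (∑ i, a i ^ 2) * ∑ i, ((toep q).mulVec b i) ^ 2 :=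
    Finset.sum_mul_sq_le_sq_mul_sq _ _ _
  have h3 := toep_bound q b H hq
  have ha : 0 ≤ ∑ i, a i ^ 2 := Finset.sum_nonneg fun i _ => sq_nonneg _
  have hbn : 0 ≤ ∑ i, b i ^ 2 := Finset.sum_nonneg fun i _ => sq_nonneg _
  rw [← h1] at h2
  rcases hbn.eq_or_lt with h | h
  · rw [← h]; positivity
  · have : (∑ i, b i ^ 2) * (∑ i, b i ^ 2) ≤ (H ^ 2 * ∑ i, a i ^ 2) * ∑ i, b i ^ 2 := by
      nlinarith [mul_le_mul_of_nonneg_left h3 ha]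
    exact le_of_mul_le_mul_right this h

lemma vecPoly_pad {r T : ℕ} (hrT : r ≤ T) (g : Fin (r - 1) → ℝ) (z : ℂ) :
    (vecPoly (pad hrT g)).eval z = ∑ t, (g t : ℂ) * z ^ ((t : ℕ) + 1) := by
  have h : vecPoly (pad hrT g) = ∑ t, Polynomial.C (g t : ℂ) * Polynomial.X ^ ((t : ℕ) + 1) := by
    ext n
    rw [vecPoly_coeff]
    simp only [Polynomial.finsetSum_coeff, Polynomial.coeff_C_mul, Polynomial.coeff_X_pow, pad]
    by_cases hn : 1 ≤ n ∧ n < r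
    · rw [dif_pos (by omega), dif_pos hn, Finset.sum_eq_single ⟨n - 1, by omega⟩]
      · rw [if_pos (by simp; omega)]; simp
      · intro b _ hb
        rw [if_neg]; · simp
        intro e; apply hb; ext; simp; omega
      · simp
    · rw [Finset.sum_eq_zero]
      · split_ifs <;> simp
      · intro b _
        rw [if_neg]; · simp
        have := b.isLt; omega
  rw [h]; simp [Polynomial.eval_finsetSum]

lemma vecPoly_pad_le {r T : ℕ} (hrT : r ≤ T) (g : Fin (r - 1) → ℝ) (z : ℂ) (hz : ‖z‖ = 1) :
    ‖(vecPoly (pad hrT g)).eval z‖ ≤ hinfNormTF (firTF g) := by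
  have hz' : ‖z⁻¹‖ = 1 := by simp [hz]
  have := le_hinfTF (rh_fir g) hz'
  rw [evalTF_fir g hz'.ge, inv_inv] at this
  rwa [vecPoly_pad]
end SLS

namespace SLS

lemma gauss_sum {Ω ι : Type} [MeasurableSpace Ω] [Fintype ι] [DecidableEq ι] (P : Measure Ω)
    [IsProbabilityMeasure P]
    (X : ι → Ω → ℝ) (v : ι → NNReal) (hX : ∀ i, Measurable (X i)) (hind : iIndepFun X P)
    (hlaw : ∀ i, P.map (X i) = gaussianReal 0 (v i)) (s : Finset ι) :
    P.map (∑ i ∈ s, X i) = gaussianReal 0 (∑ i ∈ s, v i) := by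
  induction s using Finset.induction_on with
  | empty =>
    simp only [Finset.sum_empty, gaussianReal_zero_var]
    have : (0 : Ω → ℝ) = fun _ => 0 := rfl
    rw [this, Measure.map_const]; simp
  | insert a s ha ih =>
    rw [Finset.sum_insert ha, Finset.sum_insert ha]
    have := gaussianReal_add_gaussianReal_of_indepFun
      (hind.indepFun_finsetSum_of_notMem hX ha).symm (hlaw a) ih
    simpa using this

lemma gauss_pi {ι : Type} [Fintype ι] [DecidableEq ι] {E : ι → Type} [∀ i, MeasurableSpace (E i)]
    (μ : ∀ i, Measure (E i)) [∀ i, IsProbabilityMeasure (μ i)] (f : ∀ i, E i → ℝ)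
    (hf : ∀ i, Measurable (f i)) (v : ι → NNReal)
    (hlaw : ∀ i, (μ i).map (f i) = gaussianReal 0 (v i)) :
    (Measure.pi μ).map (fun x => ∑ i, f i (x i)) = gaussianReal 0 (∑ i, v i) := by
  have h := gauss_sum (Measure.pi μ) (fun i x => f i (x i)) v
    (fun i => (hf i).comp (measurable_pi_apply i))
    (iIndepFun_pi (fun i => (hf i).aemeasurable)) ?_ Finset.univ
  · rw [← h]; congr 1; ext x; simp
  · intro i
    rw [← hlaw i, ← (measurePreserving_eval μ i).map_eq, Measure.map_map (hf i) (measurable_pi_apply i)]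
    rfl

instance instProbIid (mE T : ℕ) (σ2 : ℝ) : IsProbabilityMeasure (iidGaussianLaw mE T σ2) := by
  unfold iidGaussianLaw; infer_instance

lemma iid_linear (mE T : ℕ) (σ2 : ℝ) (hσ : 0 ≤ σ2) (c : Fin mE → Fin T → ℝ) :
    (iidGaussianLaw mE T σ2).map (fun x => ∑ k, ∑ t, c k t * x k t) =
      gaussianReal 0 (σ2 * ∑ k, ∑ t, c k t ^ 2).toNNReal := by
  have h1 : ∀ k t, (gaussianReal 0 σ2.toNNReal).map (fun x => c k t * x) =
      gaussianReal 0 (c k t ^ 2 * σ2).toNNReal := by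
    intro k t
    rw [gaussianReal_map_const_mul, mul_zero]
    congr 1
    ext
    simp [Real.toNNReal_of_nonneg, hσ, mul_nonneg, sq_nonneg]
  have h2 : ∀ k, (Measure.pi fun _ : Fin T => gaussianReal 0 σ2.toNNReal).map
      (fun x : Fin T → ℝ => ∑ t, c k t * x t) = gaussianReal 0 (∑ t, (c k t ^ 2 * σ2).toNNReal) := by
    intro k
    exact gauss_pi (fun _ : Fin T => gaussianReal 0 σ2.toNNReal) (fun t x => c k t * x)
      (fun t => by fun_prop) _ (h1 k)
  have h3 := gauss_pi (fun _ : Fin mE => (Measure.pi fun _ : Fin T => gaussianReal 0 σ2.toNNReal))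
     (fun k x => ∑ t, c k t * x t) (fun t => by fun_prop) _ h2
  unfold iidGaussianLaw
  rw [h3]
  congr 1
  ext
  rw [Real.coe_toNNReal _ (by positivity)]
  push_cast
  rw [Finset.mul_sum]
  refine Finset.sum_congr rfl fun k _ => ?_
  rw [Finset.mul_sum]
  refine Finset.sum_congr rfl fun t _ => ?_
  rw [Real.coe_toNNReal _ (by positivity), mul_comm]

lemma two_linear (mE T : ℕ) (s1 s2 : ℝ) (h1 : 0 ≤ s1) (h2 : 0 ≤ s2) (c d : Fin mE → Fin T → ℝ) :
    ((iidGaussianLaw mE T s1).prod (iidGaussianLaw mE T s2)).map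
      (fun x => (∑ k, ∑ t, c k t * x.1 k t) + ∑ k, ∑ t, d k t * x.2 k t) =
      gaussianReal 0 (s1 * (∑ k, ∑ t, c k t ^ 2) + s2 * ∑ k, ∑ t, d k t ^ 2).toNNReal := by
  have m : ∀ c : Fin mE → Fin T → ℝ,
    Measurable (fun x : Fin mE → Fin T → ℝ => ∑ k, ∑ t, c k t * x k t) := fun c => by fun_prop
  have hind := indepFun_prod (μ := iidGaussianLaw mE T s1) (ν := iidGaussianLaw mE T s2) (m c) (m d)
  have e1 := iid_linear mE T s1 h1 c
  have e2 := iid_linear mE T s2 h2 d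
  have l1 : ((iidGaussianLaw mE T s1).prod (iidGaussianLaw mE T s2)).map
      (fun x => ∑ k, ∑ t, c k t * x.1 k t) = gaussianReal 0 (s1 * ∑ k, ∑ t, c k t ^ 2).toNNReal := by
    rw [← e1, ← (measurePreserving_fst (μ := iidGaussianLaw mE T s1)
      (ν := iidGaussianLaw mE T s2)).map_eq, Measure.map_map (m c) measurable_fst,
      (measurePreserving_fst (μ := iidGaussianLaw mE T s1)
      (ν := iidGaussianLaw mE T s2)).map_eq]
    rfl
  have l2 : ((iidGaussianLaw mE T s1).prod (iidGaussianLaw mE T s2)).map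
      (fun x => ∑ k, ∑ t, d k t * x.2 k t) = gaussianReal 0 (s2 * ∑ k, ∑ t, d k t ^ 2).toNNReal := by
    rw [← e2, ← (measurePreserving_snd (μ := iidGaussianLaw mE T s1)
      (ν := iidGaussianLaw mE T s2)).map_eq, Measure.map_map (m d) measurable_snd,
      (measurePreserving_snd (μ := iidGaussianLaw mE T s1)
      (ν := iidGaussianLaw mE T s2)).map_eq]
    rfl
  have := gaussianReal_add_gaussianReal_of_indepFun hind l1 l2
  rw [Real.toNNReal_add (by positivity) (by positivity)]
  simpa [Pi.add_def] using this

lemma lintegral_exp_sq (v T : ℝ) (hv : 0 < v) (hT : 0 < T) :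
    ∫⁻ x, ENNReal.ofReal (Real.exp ((1 - 1 / T ^ 2) / 2 * (x ^ 2 / v))) ∂(gaussianReal 0 v.toNNReal)
      = ENNReal.ofReal T := by
  have hv' : v.toNNReal ≠ 0 := by simpa using hv
  rw [gaussianReal_of_var_ne_zero _ hv',
    lintegral_withDensity_eq_lintegral_mul _ (measurable_gaussianPDF _ _) (by fun_prop)]
  have hb : 0 < 1 / (2 * v * T ^ 2) := by positivity
  have e : ∀ x : ℝ, (gaussianPDF 0 v.toNNReal * fun x =>
      ENNReal.ofReal (Real.exp ((1 - 1 / T ^ 2) / 2 * (x ^ 2 / v)))) x =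
      ENNReal.ofReal ((√(2 * Real.pi * v))⁻¹ * Real.exp (-(1 / (2 * v * T ^ 2)) * x ^ 2)) := by
    intro x
    simp only [Pi.mul_apply, gaussianPDF, gaussianPDFReal, Real.coe_toNNReal _ hv.le]
    rw [← ENNReal.ofReal_mul (by positivity), mul_assoc, ← Real.exp_add]
    congr 3
    field_simp
    ring
  simp_rw [e]
  rw [← ofReal_integral_eq_lintegral_ofReal ((integrable_exp_neg_mul_sq hb).const_mul _)
    (Filter.Eventually.of_forall fun x => by positivity), integral_const_mul, integral_gaussian]
  congr 1
  rw [← Real.sqrt_inv, ← Real.sqrt_mul (by positivity)]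
  rw [show (2 * Real.pi * v)⁻¹ * (Real.pi / (1 / (2 * v * T ^ 2))) = T ^ 2 by field_simp]
  exact Real.sqrt_sq hT.le

lemma gauss_tail {Ω : Type} [MeasurableSpace Ω] (P : Measure Ω) [IsProbabilityMeasure P] {n : ℕ}
    (hn : 0 < n) (δ : Ω → Fin n → ℝ) (v : Fin n → ℝ) (hv : ∀ i, 0 < v i) (V : ℝ) (hV : ∑ i, v i ≤ V)
    (hm : ∀ i, AEMeasurable (fun ω => δ ω i) P)
    (hlaw : ∀ i, P.map (fun ω => δ ω i) = gaussianReal 0 (v i).toNNReal)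
    (η : ℝ) (hη0 : 0 < η) (hη1 : η < 1) :
    ENNReal.ofReal (1 - η) ≤
      P {ω | euclNorm (δ ω) ≤ √V * (1 + √(2 * Real.log (1 / η)))} := by
  set s := √(2 * Real.log (1 / η)) with hs
  have hlog : 0 ≤ Real.log (1 / η) := Real.log_nonneg (by rw [le_div_iff₀ hη0]; linarith)
  have hs0 : 0 ≤ s := Real.sqrt_nonneg _
  have hs2 : s ^ 2 = 2 * Real.log (1 / η) := Real.sq_sqrt (by positivity)
  have hη : η = Real.exp (-(s ^ 2 / 2)) := by
    rw [hs2, one_div, Real.log_inv, show -(2 * -Real.log η / 2) = Real.log η by ring,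
      Real.exp_log hη0]
  set W := ∑ i, v i with hW
  have hW0 : 0 < W := by
    have : Nonempty (Fin n) := ⟨⟨0, hn⟩⟩
    exact Finset.sum_pos (fun i _ => hv i) Finset.univ_nonempty
  set T := 1 + s with hT
  have hT1 : 1 ≤ T := by linarith
  have hT0 : 0 < T := by linarith
  set l := (1 - 1 / T ^ 2) / 2 with hl
  have hl0 : 0 ≤ l := by
    have : 1 / T ^ 2 ≤ 1 := by rw [div_le_one (by positivity)]; nlinarith
    rw [hl]; linarith
  have hlT : l * T ^ 2 = s + s ^ 2 / 2 := by
    rw [hl]; field_simp; rw [hT]; ring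
  set F : Ω → ℝ≥0∞ := fun ω => ENNReal.ofReal (Real.exp (l * ((∑ i, δ ω i ^ 2) / W))) with hF
  have hFm : AEMeasurable F P := by
    have : AEMeasurable (fun ω => ∑ i, δ ω i ^ 2) P :=
      Finset.aemeasurable_fun_sum _ fun i _ => (hm i).pow_const 2
    exact (Real.measurable_exp.comp_aemeasurable ((this.div_const W).const_mul l)).ennreal_ofReal
  have hFint : ∫⁻ ω, F ω ∂P ≤ ENNReal.ofReal T := by
    have hle : ∀ ω, F ω ≤ ∑ i, ENNReal.ofReal (v i / W) *
        ENNReal.ofReal (Real.exp (l * (δ ω i ^ 2 / v i))) := by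
      intro ω
      have hJ := convexOn_exp.map_sum_le (t := Finset.univ) (w := fun i => v i / W)
        (p := fun i => l * (δ ω i ^ 2 / v i)) (fun i _ => by have := hv i; positivity)
        (by rw [← Finset.sum_div]; exact div_self hW0.ne') (fun i _ => Set.mem_univ _)
      have e1 : ∑ i, (v i / W) • (l * (δ ω i ^ 2 / v i)) = l * ((∑ i, δ ω i ^ 2) / W) := by
        rw [Finset.sum_div, Finset.mul_sum]
        refine Finset.sum_congr rfl fun i _ => ?_
        have := (hv i).ne'
        simp only [smul_eq_mul]; field_simp
      rw [e1] at hJ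
      calc F ω ≤ ENNReal.ofReal (∑ i, (v i / W) • Real.exp (l * (δ ω i ^ 2 / v i))) :=
            ENNReal.ofReal_le_ofReal hJ
        _ = _ := by
            rw [ENNReal.ofReal_sum_of_nonneg]
            · refine Finset.sum_congr rfl fun i _ => ?_
              rw [smul_eq_mul, ENNReal.ofReal_mul (by have := hv i; positivity)]
            · intro i _
              have := hv i
              simp only [smul_eq_mul]; positivity
    have hi : ∀ i, ∫⁻ ω, ENNReal.ofReal (Real.exp (l * (δ ω i ^ 2 / v i))) ∂P = ENNReal.ofReal T := by
      intro i
      rw [← lintegral_exp_sq (v i) T (hv i) hT0, ← hlaw i, lintegral_map' _ (hm i)]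
      exact Measurable.aemeasurable (by fun_prop)
    have hmi : ∀ i, AEMeasurable (fun ω => ENNReal.ofReal (Real.exp (l * (δ ω i ^ 2 / v i)))) P := by
      intro i
      exact (Real.measurable_exp.comp_aemeasurable
        ((((hm i).pow_const 2).div_const (v i)).const_mul l)).ennreal_ofReal
    calc ∫⁻ ω, F ω ∂P ≤ ∫⁻ ω, ∑ i, ENNReal.ofReal (v i / W) *
        ENNReal.ofReal (Real.exp (l * (δ ω i ^ 2 / v i))) ∂P := lintegral_mono hle
      _ = ∑ i, ENNReal.ofReal (v i / W) * ENNReal.ofReal T := by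
        rw [lintegral_finsetSum' _ fun i _ => (hmi i).const_mul _]
        refine Finset.sum_congr rfl fun i _ => ?_
        rw [lintegral_const_mul'' _ (hmi i), hi]
      _ = ENNReal.ofReal T := by
        rw [← Finset.sum_mul, ← ENNReal.ofReal_sum_of_nonneg
          (fun i _ => by have := hv i; positivity), ← Finset.sum_div, div_self hW0.ne']
        simp
  set A := {ω | euclNorm (δ ω) ≤ √V * T} with hA
  have hsub : Aᶜ ⊆ {ω | ENNReal.ofReal (Real.exp (l * T ^ 2)) ≤ F ω} := by
    intro ω hω
    simp only [hA, Set.mem_compl_iff, Set.mem_ofPred_eq, not_le, euclNorm] at hω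
    have hV0 : 0 ≤ V := hW0.le.trans hV
    have h1 : V * T ^ 2 < ∑ i, δ ω i ^ 2 := by
      rw [Real.lt_sqrt (by positivity), mul_pow, Real.sq_sqrt hV0] at hω
      exact hω
    apply ENNReal.ofReal_le_ofReal
    apply Real.exp_le_exp.mpr
    apply mul_le_mul_of_nonneg_left _ hl0
    rw [le_div_iff₀ hW0]
    nlinarith [sq_nonneg T]
  have hmk := mul_meas_ge_le_lintegral₀ hFm (ENNReal.ofReal (Real.exp (l * T ^ 2)))
  have hB : P Aᶜ ≤ ENNReal.ofReal η := by
    have h2 : ENNReal.ofReal (Real.exp (l * T ^ 2)) * P Aᶜ ≤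
        ENNReal.ofReal (Real.exp (l * T ^ 2)) * ENNReal.ofReal η := by
      calc _ ≤ ENNReal.ofReal T :=
            (mul_le_mul_right (measure_mono hsub) _).trans (hmk.trans hFint)
        _ ≤ _ := by
          rw [← ENNReal.ofReal_mul (by positivity)]
          apply ENNReal.ofReal_le_ofReal
          rw [hη, ← Real.exp_add, hlT, show s + s ^ 2 / 2 + -(s ^ 2 / 2) = s by ring, hT]
          linarith [Real.add_one_le_exp s]
    refine (ENNReal.mul_le_mul_iff_right ?_ ENNReal.ofReal_ne_top).mp h2
    simp [Real.exp_pos]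
  rw [ENNReal.ofReal_sub _ hη0.le, ENNReal.ofReal_one, tsub_le_iff_right]
  calc (1 : ℝ≥0∞) = P Set.univ := measure_univ.symm
    _ = P (A ∪ Aᶜ) := by rw [Set.union_compl_self]
    _ ≤ P A + P Aᶜ := measure_union_le _ _
    _ ≤ _ := by gcongr
end SLS

namespace SLS

/-- The least-squares matrix. -/
def lsMat {T mE : ℕ} (u : Fin mE → Fin T → ℝ) : Matrix (Fin T) (Fin mE × Fin T) ℝ :=
  (ZtZ u)⁻¹ * (Zmat u)ᵀ

lemma lsMat_mul {T mE : ℕ} (u : Fin mE → Fin T → ℝ) (hinv : IsUnit (ZtZ u).det) :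
    lsMat u * Zmat u = 1 := by
  rw [lsMat, Matrix.mul_assoc]
  exact Matrix.nonsing_inv_mul _ hinv

lemma lsMat_sq {T mE : ℕ} (u : Fin mE → Fin T → ℝ) (hinv : IsUnit (ZtZ u).det) (i : Fin T) :
    ∑ k, ∑ t, lsMat u i (k, t) ^ 2 = (ZtZ u)⁻¹ i i := by
  have h : lsMat u * (lsMat u)ᵀ = ((ZtZ u)⁻¹)ᵀ := by
    conv_lhs => rw [show (lsMat u)ᵀ = Zmat u * ((ZtZ u)⁻¹)ᵀ by
      rw [lsMat, Matrix.transpose_mul, Matrix.transpose_transpose]]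
    rw [← Matrix.mul_assoc, lsMat_mul u hinv, Matrix.one_mul]
  have h2 := congrFun (congrFun h i) i
  rw [Matrix.mul_apply, Matrix.transpose_apply, Fintype.sum_prod_type] at h2
  rw [← h2]
  refine Finset.sum_congr rfl fun k _ => Finset.sum_congr rfl fun t _ => ?_
  rw [Matrix.transpose_apply]; ring

lemma inv_diag_pos {T mE : ℕ} (u : Fin mE → Fin T → ℝ) (hinv : IsUnit (ZtZ u).det) (i : Fin T) :
    0 < (ZtZ u)⁻¹ i i := by
  rw [← lsMat_sq u hinv]
  have hnn : 0 ≤ ∑ k, ∑ t, lsMat u i (k, t) ^ 2 := by positivity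
  refine lt_of_le_of_ne hnn fun h0 => ?_
  have hz : ∀ k t, lsMat u i (k, t) = 0 := by
    intro k t
    have h1 := (Finset.sum_eq_zero_iff_of_nonneg (fun k _ => by positivity)).mp h0.symm k
      (Finset.mem_univ _)
    have h2 := (Finset.sum_eq_zero_iff_of_nonneg (fun k _ => by positivity)).mp h1 t
      (Finset.mem_univ _)
    exact pow_eq_zero_iff (two_ne_zero) |>.mp h2
  have h2 := congrFun (congrFun (lsMat_mul u hinv) i) i
  rw [Matrix.mul_apply, Fintype.sum_prod_type, Matrix.one_apply_eq] at h2
  simp [hz] at h2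

lemma lsEst_err {T mE : ℕ} (u : Fin mE → Fin T → ℝ) (hinv : IsUnit (ZtZ u).det)
    (q : Fin T → ℝ) (noise : Fin mE → Fin T → ℝ) (i : Fin T) :
    lsEst u (fun k => (toep (u k)).mulVec q + noise k) i =
      q i + ∑ k, ∑ t, lsMat u i (k, t) * noise k t := by
  have h : lsEst u (fun k => (toep (u k)).mulVec q + noise k) =
      (lsMat u).mulVec ((Zmat u).mulVec q) + (lsMat u).mulVec (fun pr => noise pr.1 pr.2) := by
    rw [← Matrix.mulVec_add]
    rfl
  rw [h, Matrix.mulVec_mulVec, lsMat_mul u hinv, Matrix.one_mulVec, Pi.add_apply]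
  congr 1
  simp only [Matrix.mulVec, dotProduct, Fintype.sum_prod_type]

lemma coarse_err {r T mE : ℕ} (hrT : r ≤ T) (u : Fin mE → Fin T → ℝ) (hinv : IsUnit (ZtZ u).det)
    (g : Fin (r - 1) → ℝ) (w ξ : Fin mE → Fin T → ℝ) (i : Fin (r - 1)) (j : Fin T)
    (hj : (j : ℕ) = i + 1) :
    (coarseEst hrT u g (fun k => (toep (pad hrT g)).mulVec (w k) + ξ k) - g) i =
      (∑ k, ∑ t, Matrix.vecMul (fun t => lsMat u j (k, t)) (toep (pad hrT g)) t * w k t) +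
      ∑ k, ∑ t, lsMat u j (k, t) * ξ k t := by
  have hlt : (i : ℕ) + 1 < T := by have := i.isLt; omega
  obtain rfl : j = ⟨(i : ℕ) + 1, hlt⟩ := Fin.ext hj
  rw [Pi.sub_apply, coarseEst, lsEst_err u hinv]
  have hp : pad hrT g ⟨(i : ℕ) + 1, by have := i.isLt; omega⟩ = g i := by
    unfold pad
    rw [dif_pos ⟨by simp, by have := i.isLt; simp only []; omega⟩]
    congr 1
  rw [hp, add_sub_cancel_left, ← Finset.sum_add_distrib]
  refine Finset.sum_congr rfl fun k _ => ?_
  have := Matrix.dotProduct_mulVec (fun t => lsMat u ⟨(i : ℕ) + 1, by have := i.isLt; omega⟩ (k, t))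
    (toep (pad hrT g)) (w k)
  simp only [dotProduct] at this
  rw [← this, ← Finset.sum_add_distrib]
  refine Finset.sum_congr rfl fun t _ => ?_
  simp only [Pi.add_apply]; ring

lemma sum_diag_le {r T : ℕ} (hrT : r ≤ T) (S : Matrix (Fin T) (Fin T) ℝ) (hS : ∀ i, 0 ≤ S i i) 
    (f : Fin (r - 1) → Fin T) (hf : ∀ i, (f i : ℕ) = i + 1) :
    ∑ i, S (f i) (f i) ≤ (S.submatrix (Fin.castLE hrT) (Fin.castLE hrT)).trace := by
  let e : Fin (r - 1) ↪ Fin r := ⟨fun i => ⟨i + 1, by have := i.isLt; omega⟩, by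
    intro a b h; simp at h; exact Fin.ext h⟩
  have h1 : ∑ i, S (f i) (f i) = ∑ j ∈ Finset.univ.map e, S (Fin.castLE hrT j) (Fin.castLE hrT j) := by
    rw [Finset.sum_map]
    refine Finset.sum_congr rfl fun i _ => ?_
    have : Fin.castLE hrT (e i) = f i := Fin.ext (by rw [hf]; rfl)
    rw [this]
  rw [h1]
  exact Finset.sum_le_univ_sum_of_nonneg fun j => hS _

lemma hinfNorm_empty {n m : ℕ} (hn : n = 0) (F : TMat n m) : hinfNorm F ≤ 0 := by
  subst hn
  apply Real.sSup_nonpos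
  rintro x ⟨z, _, rfl⟩
  unfold specNorm
  exact ContinuousLinearMap.opNorm_le_bound _ le_rfl fun x => by
    rw [Subsingleton.elim (LinearMap.toContinuousLinearMap (Matrix.toEuclideanLin (evalMat F z)) x) 0]
    simp

end SLS


/-- end-to-end Coarse-ID control with process and measurement noise:
each experiment output is `y_i = Toep(u_i)g_{0:T−1} + Toep(g_{0:T−1})w_i + ξ_i` with
`w_i ~ N(0, σ_w²I)` and `ξ_i ~ N(0, σ_ξ²I)` i.i.d. and independent of each other.
Then the end-to-end Coarse-ID control theorem holds with `σ²` replaced by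
`σ_w²‖G‖² + σ_ξ²`, where `‖G‖` is the H∞ norm of the true plant. -/
theorem statement_1 (r T mE nw : ℕ) (hrT : r ≤ T)
    (g : Fin (r - 1) → ℝ)
    (B₁ : Matrix (Fin (r - 1)) (Fin nw) ℝ) (D₂₁ : Matrix (Fin 1) (Fin nw) ℝ)
    (D₁₁ : Matrix (Fin 2) (Fin nw) ℝ)
    (σw σξ η : ℝ) (hσw : 0 < σw) (hσξ : 0 < σξ) (hη0 : 0 < η) (hη1 : η < 1)
    (p : ℝ≥0∞) (hp : 1 ≤ p)
    {Ω : Type} [MeasurableSpace Ω] (P : Measure Ω) [IsProbabilityMeasure P]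
    (w ξ : Ω → Fin mE → Fin T → ℝ)
    (hlaw : Measure.map (fun ω => (w ω, ξ ω)) P =
      (iidGaussianLaw mE T (σw ^ 2)).prod (iidGaussianLaw mE T (σξ ^ 2)))
    (u : Fin mE → Fin T → ℝ)
    (hu : ∀ i, lpNorm p (u i) ≤ 1)
    (hinv : IsUnit (ZtZ u).det)
    (hS : (((ZtZ u)⁻¹).submatrix (Fin.castLE hrT) (Fin.castLE hrT)).trace ≤
      4 * Real.log 2 * rExp p r / mE)
    (Θ₀ : Response (r - 1) 1 1)
    (hΘ₀ : OptimalResponse g B₁ D₂₁ D₁₁ Θ₀)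
    (s2 : ℝ)
    (hs2 : s2 = σw ^ 2 * hinfNormTF (firTF g) ^ 2 + σξ ^ 2)
    (ε : ℝ)
    (hεdef : ε = 2 * Real.sqrt (Real.log 2 * s2 * rExp p r / mE) *
      (1 + Real.sqrt (2 * Real.log (1 / η))))
    (hεsmall : ε < 1 / (4 * hinfNorm Θ₀.N))
    (Θt : Ω → Response (r - 1) 1 1) (α : Ω → ℝ)
    (hopt : ∀ ω, RobustOptimal
      (coarseEst hrT u g (fun k => (toep (pad hrT g)).mulVec (w ω k) + ξ ω k))
      B₁ D₂₁ D₁₁ ε (Θt ω) (α ω)) :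
    ENNReal.ofReal (1 - η) ≤
      P {ω | ∃ Θhat : Response (r - 1) 1 1,
        Achieves (shiftMat (r - 1)) (e1 (r - 1)) (rowVec g) (controller (Θt ω)) Θhat ∧
        SLSStable Θhat ∧
        cost g B₁ D₂₁ D₁₁ Θhat - cost g B₁ D₂₁ D₁₁ Θ₀ ≤
          8 * Real.sqrt (Real.log 2 * s2 * rExp p r / mE) *
            (1 + Real.sqrt (2 * Real.log (1 / η))) * perfWeight g Θ₀ *
            hinfNorm (Θ₀.R * rmap B₁ + Θ₀.N * rmap D₂₁)} := by
  have hε0 : 0 ≤ ε := by rw [hεdef]; positivity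
  have hN : 0 < hinfNorm Θ₀.N := by
    refine lt_of_le_of_ne (hinf_nonneg _) fun h => ?_
    rw [← h] at hεsmall
    simp at hεsmall
    linarith
  have hεN : ε * hinfNorm Θ₀.N < 1 / 4 := by
    rw [lt_div_iff₀ (by positivity)] at hεsmall
    linarith
  have hr : 0 < r - 1 := by
    rcases Nat.eq_zero_or_pos (r - 1) with h | h
    · exact absurd (hinfNorm_empty h Θ₀.N) (not_le.mpr hN)
    · exact h
  have hV : √(4 * Real.log 2 * s2 * rExp p r / mE) = 2 * √(Real.log 2 * s2 * rExp p r / mE) := by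
    rw [show 4 * Real.log 2 * s2 * rExp p r / mE = 2 ^ 2 * (Real.log 2 * s2 * rExp p r / mE) by ring,
      Real.sqrt_mul (by norm_num), Real.sqrt_sq (by norm_num)]
  let f : Fin (r - 1) → Fin T := fun i => ⟨i + 1, by have := i.isLt; omega⟩
  let q := pad hrT g
  let d : Fin (r - 1) → Fin mE → Fin T → ℝ := fun i k t => lsMat u (f i) (k, t)
  let c : Fin (r - 1) → Fin mE → Fin T → ℝ := fun i k => Matrix.vecMul (d i k) (toep q)
  let v : Fin (r - 1) → ℝ := fun i =>
    σw ^ 2 * (∑ k, ∑ t, c i k t ^ 2) + σξ ^ 2 * ∑ k, ∑ t, d i k t ^ 2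
  have hd : ∀ i, ∑ k, ∑ t, d i k t ^ 2 = (ZtZ u)⁻¹ (f i) (f i) := fun i => lsMat_sq u hinv (f i)
  have hdpos : ∀ i, 0 < ∑ k, ∑ t, d i k t ^ 2 := fun i => by
    rw [hd]; exact inv_diag_pos u hinv _
  have hv : ∀ i, 0 < v i := by
    intro i
    have := hdpos i
    have h0 : 0 ≤ ∑ k, ∑ t, c i k t ^ 2 := by positivity
    simp only [v]
    positivity
  have hvle : ∀ i, v i ≤ s2 * (ZtZ u)⁻¹ (f i) (f i) := by
    intro i
    have h1 : ∑ k, ∑ t, c i k t ^ 2 ≤ hinfNormTF (firTF g) ^ 2 * ∑ k, ∑ t, d i k t ^ 2 := by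
      rw [Finset.mul_sum]
      refine Finset.sum_le_sum fun k _ => ?_
      exact toepT_bound q (d i k) _ (vecPoly_pad_le hrT g)
    rw [← hd, hs2]
    simp only [v]
    nlinarith [mul_le_mul_of_nonneg_left h1 (sq_nonneg σw)]
  have hs2' : 0 ≤ s2 := by rw [hs2]; positivity
  have hvV : ∑ i, v i ≤ 4 * Real.log 2 * s2 * rExp p r / mE := by
    calc ∑ i, v i ≤ ∑ i, s2 * (ZtZ u)⁻¹ (f i) (f i) := Finset.sum_le_sum fun i _ => hvle i
      _ = s2 * ∑ i, (ZtZ u)⁻¹ (f i) (f i) := by rw [Finset.mul_sum]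
      _ ≤ s2 * (4 * Real.log 2 * rExp p r / mE) := by
        apply mul_le_mul_of_nonneg_left _ hs2'
        exact (sum_diag_le hrT _ (fun i => (inv_diag_pos u hinv i).le) f (fun i => rfl)).trans hS
      _ = _ := by ring
  have hWm : AEMeasurable (fun ω => (w ω, ξ ω)) P := by
    apply AEMeasurable.of_map_ne_zero
    rw [hlaw]; exact NeZero.ne _
  let δ : Ω → Fin (r - 1) → ℝ := fun ω =>
    coarseEst hrT u g (fun k => (toep (pad hrT g)).mulVec (w ω k) + ξ ω k) - g
  let φ : Fin (r - 1) → (Fin mE → Fin T → ℝ) × (Fin mE → Fin T → ℝ) → ℝ := fun i x =>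
    (∑ k, ∑ t, c i k t * x.1 k t) + ∑ k, ∑ t, d i k t * x.2 k t
  have hφ : ∀ i, Measurable (φ i) := fun i => by fun_prop
  have hδ : ∀ i, (fun ω => δ ω i) = φ i ∘ fun ω => (w ω, ξ ω) := by
    intro i; ext ω
    exact coarse_err hrT u hinv g (w ω) (ξ ω) i (f i) rfl
  have hm : ∀ i, AEMeasurable (fun ω => δ ω i) P := by
    intro i; rw [hδ]; exact (hφ i).comp_aemeasurable hWm
  have hl : ∀ i, P.map (fun ω => δ ω i) = gaussianReal 0 (v i).toNNReal := by
    intro i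
    rw [hδ, ← AEMeasurable.map_map_of_aemeasurable (hφ i).aemeasurable hWm, hlaw]
    exact two_linear mE T (σw ^ 2) (σξ ^ 2) (by positivity) (by positivity) (c i) (d i)
  refine (gauss_tail P hr δ v hv _ hvV hm hl η hη0 hη1).trans (measure_mono ?_)
  intro ω hω
  have hω' : euclNorm (δ ω) ≤ ε := by
    rw [hεdef, ← hV]; exact hω
  obtain ⟨Θhat, h1, h2, h3⟩ := deterministic g _ B₁ D₂₁ D₁₁ ε Θ₀ (Θt ω) (α ω) hΘ₀ (hopt ω) hεN hω'
  refine ⟨Θhat, h1, h2, h3.trans (le_of_eq ?_)⟩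
  rw [hεdef]; ring
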